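/- arXiv:2207.12012 — 2 statements merged into one kernel-verified Lean document; each statement's English description precedes it below -/
import Mathlib

section
/- Let k be a field of characteristic 0 and g a Lie algebra over k. Each differential dₙ : Vₙ(g) → Vₙ₋₁(g) of the Chevalley–Eilenberg–Koszul complex is a homomorphism of left U(g)-modules, and dₙ₋₁ ∘ dₙ = 0 for all n ≥ 2; hence V•(g) is a chain complex of left U(g)-modules. -/
/-!
STATEMENT 2: for a Lie algebra `g` over a field `k` of characteristic `0`, the differentials
`dₙ : Vₙ(g) → Vₙ₋₁(g)` of the Chevalley–Eilenberg–Koszul complex `Vₙ(g) = U(g) ⊗ₖ ⋀ⁿg`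
(hypothesized below by their defining formula on the generators `u ⊗ g₁∧⋯∧gₙ`, `0`-indexed)
are homomorphisms of left `U(g)`-modules and satisfy `dₙ₋₁ ∘ dₙ = 0` for all `n ≥ 2`;
hence `V•(g)` is a chain complex of left `U(g)`-modules.  (We index so that
`d n : Vₙ₊₁(g) → Vₙ(g)`.)
-/

open TensorProduct

set_option synthInstance.maxHeartbeats 1000000
set_option maxHeartbeats 1000000

/-- The index (in a tuple of length `n + 1`) of the `m`-th entry remaining after the entries in
positions `i < j` have been deleted. -/
def remove2Idx (i j m : ℕ) : ℕ :=
  if m < i then m else if m + 1 < j then m + 1 else m + 2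

/-- Given a tuple `x = (x₀, …, xₙ)` of length `n + 1`, two indices `i < j`, and an element `a`,
this is the `n`-tuple `(a, x₀, …, x̂ᵢ, …, x̂ⱼ, …, xₙ)` (hats mean omitted entries). -/
def consRemove2 {α : Type*} {n : ℕ} (a : α) (x : Fin (n + 1) → α) (i j : Fin (n + 1)) :
    Fin n → α := fun l =>
  if h : (l : ℕ) = 0 then a
  else
    x ⟨remove2Idx (i : ℕ) (j : ℕ) ((l : ℕ) - 1), by
      have h1 := l.isLt
      have h2 : 1 ≤ (l : ℕ) := Nat.one_le_iff_ne_zero.mpr h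
      unfold remove2Idx
      split
      · omega
      · split <;> omega⟩

/-- The wedge `v₀ ∧ ⋯ ∧ vₙ₋₁` as an element of the `n`-th exterior power `⋀[k]^n V`. -/
noncomputable def wedge (k : Type*) [CommRing k] {V : Type*} [AddCommGroup V] [Module k V]
    (n : ℕ) (v : Fin n → V) : ⋀[k]^n V :=
  ⟨ExteriorAlgebra.ιMulti k n v, ExteriorAlgebra.ιMulti_range k n ⟨v, rfl⟩⟩

/-- The abstract Cartan-calculus argument. -/
theorem cartan_sq_zero {k g : Type*} [Field k] [LieRing g]
    (V : ℕ → Type*) [∀ n, AddCommGroup (V n)] [∀ n, Module k (V n)]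
    (e : ∀ n, g → V n →ₗ[k] V (n + 1)) (d : ∀ n, V (n + 1) →ₗ[k] V n)
    (θ : ∀ n, g → V n →ₗ[k] V n)
    (he : ∀ n x y m, e n (x + y) m = e n x m + e n y m)
    (h0 : ∀ x m, d 0 (e 0 x m) = θ 0 x m)
    (h1 : ∀ n x m, d (n + 1) (e (n + 1) x m) = θ (n + 1) x m - e n x (d n m))
    (h2 : ∀ n x y m, θ (n + 1) x (e n y m) = e n y (θ n x m) - e n ⁅x, y⁆ m)
    (h3 : ∀ x y m, θ 0 x (θ 0 y m) = θ 0 y (θ 0 x m) - θ 0 ⁅x, y⁆ m)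
    (hs : ∀ n (p : V (n + 1) → Prop), (∀ x m, p (e n x m)) → p 0 →
      (∀ a b, p a → p b → p (a + b)) → ∀ m, p m) :
    ∀ n m, d n (d (n + 1) m) = 0 := by
  have h4 : ∀ n x y m, θ n x (θ n y m) = θ n y (θ n x m) - θ n ⁅x, y⁆ m := by
    intro n
    induction n with
    | zero => exact h3
    | succ n ih =>
      intro x y
      refine hs n _ ?_ (by simp) ?_
      · intro z m
        have hj : e n ⁅x, ⁅y, z⁆⁆ m = e n ⁅⁅x, y⁆, z⁆ m + e n ⁅y, ⁅x, z⁆⁆ m := by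
          rw [← he, leibniz_lie]
        simp only [h2, map_sub, ih x y, hj]
        abel
      · intro a b ha hb
        simp only [map_add, ha, hb]
        abel
  have h5 : ∀ n x m, d n (θ (n + 1) x m) = θ n x (d n m) := by
    intro n
    induction n with
    | zero =>
      intro x
      refine hs 0 _ ?_ (by simp) ?_
      · intro y m
        simp only [h2, map_sub, h0, h4 0 x y]
      · intro a b ha hb
        simp only [map_add, ha, hb]
    | succ n ih =>
      intro x
      refine hs (n + 1) _ ?_ (by simp) ?_
      · intro y m
        simp only [h2, map_sub, h1, h4 (n + 1) x y, ih]
        abel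
      · intro a b ha hb
        simp only [map_add, ha, hb]
  intro n
  induction n with
  | zero =>
    refine hs 1 _ ?_ (by simp) ?_
    · intro x m
      simp only [h1, h0, map_sub, h5, sub_self]
    · intro a b ha hb
      simp only [map_add, ha, hb, add_zero]
  | succ n ih =>
    refine hs (n + 2) _ ?_ (by simp) ?_
    · intro x m
      simp only [h1, map_sub, h5, ih, map_zero, sub_zero, sub_self]
    · intro a b ha hb
      simp only [map_add, ha, hb, add_zero]

theorem consRemove2_zero_succ {α : Type*} {n : ℕ} (a x : α) (v : Fin (n + 1) → α)
    (j : Fin (n + 1)) :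
    consRemove2 a (Fin.cons x v : Fin (n + 2) → α) 0 j.succ = Fin.cons a (j.removeNth v) := by
  funext l
  refine Fin.cases ?_ (fun l => ?_) l
  · simp [consRemove2]
  · have : (⟨remove2Idx 0 (j + 1) l, by
        have := l.isLt
        unfold remove2Idx; split
        · omega
        · split <;> omega⟩ : Fin (n + 2)) = (j.succAbove l).succ := by
      ext
      simp only [remove2Idx, Fin.succAbove, Fin.val_succ, Fin.lt_def]
      split_ifs <;> simp_all <;> omega
    simp [consRemove2, Fin.removeNth, this]

theorem consRemove2_succ_succ {α : Type*} {n : ℕ} (a x : α) (v : Fin (n + 2) → α)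
    (i j : Fin (n + 2)) :
    consRemove2 a (Fin.cons x v : Fin (n + 3) → α) i.succ j.succ =
      (Fin.cons x (consRemove2 a v i j) : Fin (n + 2) → α) ∘ Equiv.swap 0 1 := by
  funext l
  refine Fin.cases ?_ (fun l => Fin.cases ?_ (fun l => ?_) l) l
  · simp only [Function.comp, Equiv.swap_apply_left]
    rw [show (1 : Fin (n + 2)) = Fin.succ 0 from rfl, Fin.cons_succ]
    simp [consRemove2]
  · have : Equiv.swap (0 : Fin (n + 2)) 1 (Fin.succ 0) = 0 := Equiv.swap_apply_right _ _
    simp only [Function.comp, this, Fin.cons_zero]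
    simp [consRemove2, remove2Idx]
  · have : Equiv.swap (0 : Fin (n + 2)) 1 l.succ.succ = l.succ.succ := by
      apply Equiv.swap_apply_of_ne_of_ne
      · exact Fin.succ_ne_zero _
      · rw [show (1 : Fin (n + 2)) = Fin.succ 0 from rfl]
        exact fun h => Fin.succ_ne_zero _ (Fin.succ_injective _ h)
    simp only [Function.comp, this, Fin.cons_succ]
    have h2 : ∀ h h', (⟨remove2Idx (i + 1) (j + 1) (l + 1), h⟩ : Fin (n + 3)) =
        (⟨remove2Idx i j l, h'⟩ : Fin (n + 2)).succ := by
      intro h h'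
      ext
      simp only [remove2Idx, Fin.val_succ]
      split_ifs <;> omega
    have hb : remove2Idx i j l < n + 2 := by
      have := l.isLt
      unfold remove2Idx; split
      · omega
      · split <;> omega
    simp [consRemove2, h2 _ hb]
    rfl

theorem wedge_eq (k : Type*) [CommRing k] {V : Type*} [AddCommGroup V] [Module k V]
    (n : ℕ) (v : Fin n → V) : wedge k n v = exteriorPower.ιMulti k n v := rfl

/-- Exterior multiplication by `x` on the left of the exterior factor. -/
noncomputable def extMul (k g : Type*) [Field k] [LieRing g] [LieAlgebra k g] (n : ℕ) (x : g) :
    (UniversalEnvelopingAlgebra k g ⊗[k] ⋀[k]^n g) →ₗ[k]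
      (UniversalEnvelopingAlgebra k g ⊗[k] ⋀[k]^(n + 1) g) :=
  LinearMap.lTensor _
    (exteriorPower.alternatingMapLinearEquiv ((exteriorPower.ιMulti k (n + 1)).curryLeft x))

theorem extMul_wedge (k g : Type*) [Field k] [LieRing g] [LieAlgebra k g] (n : ℕ) (x : g)
    (u : UniversalEnvelopingAlgebra k g) (v : Fin n → g) :
    extMul k g n x (u ⊗ₜ wedge k n v) = u ⊗ₜ wedge k (n + 1) (Fin.cons x v) := by
  simp only [extMul, wedge_eq, LinearMap.lTensor_tmul,
    exteriorPower.alternatingMapLinearEquiv_apply_ιMulti, AlternatingMap.curryLeft_apply_apply]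
  rfl

theorem koszul_induction (k g : Type*) [Field k] [LieRing g] [LieAlgebra k g] (n : ℕ)
    (p : UniversalEnvelopingAlgebra k g ⊗[k] ⋀[k]^n g → Prop)
    (hw : ∀ u v, p (u ⊗ₜ wedge k n v)) (h0 : p 0) (ha : ∀ a b, p a → p b → p (a + b)) :
    ∀ m, p m := by
  intro m
  induction m with
  | zero => exact h0
  | add a b iha ihb => exact ha _ _ iha ihb
  | tmul u w =>
    have hmem : w ∈ Submodule.span k (Set.range (exteriorPower.ιMulti k n (M := g))) := by
      rw [exteriorPower.ιMulti_span]; trivial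
    induction hmem using Submodule.span_induction generalizing u with
    | mem y hy => obtain ⟨v, rfl⟩ := hy; exact hw u v
    | zero => simpa using h0
    | add a b _ _ iha ihb => rw [TensorProduct.tmul_add]; exact ha _ _ (iha u) (ihb u)
    | smul c a _ iha =>
      rw [← TensorProduct.smul_tmul]; exact iha _

theorem wedge_cons_removeNth (k : Type*) [Field k] {V : Type*} [AddCommGroup V] [Module k V]
    (n : ℕ) (a : V) (v : Fin (n + 1) → V) (j : Fin (n + 1)) :
    wedge k (n + 1) (Fin.cons a (j.removeNth v)) =
      ((-1 : k) ^ (j : ℕ)) • wedge k (n + 1) (Function.update v j a) := by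
  rw [wedge_eq, wedge_eq, ← Fin.insertNth_removeNth, AlternatingMap.map_insertNth]
  rcases neg_one_pow_eq_or ℤ (j : ℕ) with h | h
  · have h' : (-1 : k) ^ (j : ℕ) = 1 := by exact_mod_cast congrArg (Int.cast : ℤ → k) h
    rw [h, h']; simp; rfl
  · have h' : (-1 : k) ^ (j : ℕ) = -1 := by
      have := congrArg (Int.cast : ℤ → k) h
      push_cast at this; exact this
    rw [h, h']; simp; rfl

theorem wedge_consRemove2_succ_succ (k : Type*) [Field k] {V : Type*} [AddCommGroup V]
    [Module k V] (n : ℕ) (a x : V) (v : Fin (n + 1) → V) (i j : Fin (n + 1)) (hij : i < j) :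
    wedge k (n + 1) (consRemove2 a (Fin.cons x v : Fin (n + 2) → V) i.succ j.succ) =
      - wedge k (n + 1) (Fin.cons x (consRemove2 a v i j)) := by
  cases n with
  | zero => omega
  | succ n =>
    rw [consRemove2_succ_succ, wedge_eq, wedge_eq, AlternatingMap.map_swap]
    simp

section
variable {k g : Type*} [Field k] [LieRing g] [LieAlgebra k g]

/-- The Lie derivative, written on generators. -/
noncomputable def lieDer (n : ℕ) (x : g) (u : UniversalEnvelopingAlgebra k g) (v : Fin n → g) :
    UniversalEnvelopingAlgebra k g ⊗[k] ⋀[k]^n g :=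
  (u * UniversalEnvelopingAlgebra.ι k x) ⊗ₜ wedge k n v -
    ∑ j, u ⊗ₜ wedge k n (Function.update v j ⁅x, v j⁆)

theorem koszul_cartan
    (d : ∀ n : ℕ,
      (UniversalEnvelopingAlgebra k g ⊗[k] ⋀[k]^(n + 1) g) →ₗ[k]
        (UniversalEnvelopingAlgebra k g ⊗[k] ⋀[k]^n g))
    (hd : ∀ (n : ℕ) (u : UniversalEnvelopingAlgebra k g) (v : Fin (n + 1) → g),
      d n (u ⊗ₜ[k] wedge k (n + 1) v) =
        (∑ i : Fin (n + 1),
            ((-1 : k) ^ (i : ℕ)) •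
              ((u * UniversalEnvelopingAlgebra.ι k (v i)) ⊗ₜ[k] wedge k n (v ∘ i.succAbove))) +
          ∑ p : Fin (n + 1) × Fin (n + 1),
            if p.1 < p.2 then
              ((-1 : k) ^ ((p.1 : ℕ) + (p.2 : ℕ))) •
                (u ⊗ₜ[k] wedge k n (consRemove2 ⁅v p.1, v p.2⁆ v p.1 p.2))
            else 0)
    (n : ℕ) (x : g) (u : UniversalEnvelopingAlgebra k g) (v : Fin (n + 1) → g) :
    d (n + 1) (extMul k g (n + 1) x (u ⊗ₜ wedge k (n + 1) v)) +
      extMul k g n x (d n (u ⊗ₜ wedge k (n + 1) v)) = lieDer (n + 1) x u v := by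
  rw [extMul_wedge, hd, hd, map_add, map_sum, map_sum, Fin.sum_univ_succ]
  simp only [Fintype.sum_prod_type, apply_ite (extMul k g n x), map_zero, map_smul, extMul_wedge]
  rw [Fin.sum_univ_succ (n := n + 1)
    (f := fun i => ∑ j, if (i, j).1 < (i, j).2 then _ else _)]
  simp only [Fin.sum_univ_succ (n := n + 1), Fin.cons_zero, Fin.cons_succ,
    Fin.cons_comp_succ_succAbove, consRemove2_zero_succ, Fin.succ_lt_succ_iff, Fin.not_lt_zero,
    lt_irrefl, if_false, Fin.succ_pos, if_true, wedge_cons_removeNth, zero_add, add_zero]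
  have e1 : ∀ i j : Fin (n + 1),
      (if i < j then ((-1 : k) ^ ((i.succ : ℕ) + (j.succ : ℕ))) •
        (u ⊗ₜ[k] wedge k (n + 1)
          (consRemove2 ⁅v i, v j⁆ (Fin.cons x v : Fin (n + 2) → g) i.succ j.succ)) else 0) =
      - (if i < j then ((-1 : k) ^ ((i : ℕ) + (j : ℕ))) •
        (u ⊗ₜ[k] wedge k (n + 1)
          (Fin.cons x (consRemove2 ⁅v i, v j⁆ v i j))) else 0) := by
    intro i j
    split_ifs with h
    · rw [wedge_consRemove2_succ_succ _ _ _ _ _ _ _ h, TensorProduct.tmul_neg, smul_neg,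
        Fin.val_succ, Fin.val_succ, show (i : ℕ) + 1 + (j + 1) = i + j + 2 by ring, pow_add]
      simp
    · simp
  have e2 : ∀ j : Fin (n + 1), ((-1 : k) ^ (((0 : Fin (n + 2)) : ℕ) + (j.succ : ℕ))) •
      (u ⊗ₜ[k] (((-1 : k) ^ (j : ℕ)) • wedge k (n + 1) (Function.update v j ⁅x, v j⁆))) =
      - (u ⊗ₜ[k] wedge k (n + 1) (Function.update v j ⁅x, v j⁆)) := by
    intro j
    rw [TensorProduct.tmul_smul, smul_smul, ← pow_add, Fin.val_succ, Fin.val_zero,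
      show 0 + ((j : ℕ) + 1) + j = 2 * j + 1 by ring, pow_succ, pow_mul]
    simp
  have e3 : ((Fin.cons x v : Fin (n + 2) → g) ∘ (0 : Fin (n + 2)).succAbove) = v := by
    funext l; simp
  have e4 : ∀ i : Fin (n + 1), v ∘ i.succAbove = i.removeNth v := fun i => rfl
  have e5 : ∀ (c : k) (w : UniversalEnvelopingAlgebra k g ⊗[k] ⋀[k]^(n + 1) g),
      (-c) • w = - (c • w) := fun c w => neg_smul c w
  simp only [e1, e2, e3, e4]
  simp only [lieDer, wedge_cons_removeNth, Fin.val_succ, Fin.val_zero, pow_zero,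
    one_smul, Finset.sum_neg_distrib, pow_succ, mul_neg, mul_one, e5]
  abel

theorem koszul_cartan_zero
    (d : ∀ n : ℕ,
      (UniversalEnvelopingAlgebra k g ⊗[k] ⋀[k]^(n + 1) g) →ₗ[k]
        (UniversalEnvelopingAlgebra k g ⊗[k] ⋀[k]^n g))
    (hd : ∀ (n : ℕ) (u : UniversalEnvelopingAlgebra k g) (v : Fin (n + 1) → g),
      d n (u ⊗ₜ[k] wedge k (n + 1) v) =
        (∑ i : Fin (n + 1),
            ((-1 : k) ^ (i : ℕ)) •
              ((u * UniversalEnvelopingAlgebra.ι k (v i)) ⊗ₜ[k] wedge k n (v ∘ i.succAbove))) +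
          ∑ p : Fin (n + 1) × Fin (n + 1),
            if p.1 < p.2 then
              ((-1 : k) ^ ((p.1 : ℕ) + (p.2 : ℕ))) •
                (u ⊗ₜ[k] wedge k n (consRemove2 ⁅v p.1, v p.2⁆ v p.1 p.2))
            else 0)
    (x : g) (u : UniversalEnvelopingAlgebra k g) (v : Fin 0 → g) :
    d 0 (extMul k g 0 x (u ⊗ₜ wedge k 0 v)) = lieDer 0 x u v := by
  rw [extMul_wedge, hd]
  have e3 : ((Fin.cons x v : Fin 1 → g) ∘ (0 : Fin 1).succAbove) = v := Subsingleton.elim _ _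
  simp [lieDer, Fintype.sum_prod_type, e3]

theorem uea_ι_lie (x y : g) : UniversalEnvelopingAlgebra.ι k ⁅x, y⁆ =
    UniversalEnvelopingAlgebra.ι k x * UniversalEnvelopingAlgebra.ι k y -
      UniversalEnvelopingAlgebra.ι k y * UniversalEnvelopingAlgebra.ι k x := by
  letI : LieRing (UniversalEnvelopingAlgebra k g) := LieRing.ofAssociativeRing
  exact LieHom.map_lie (UniversalEnvelopingAlgebra.ι k) x y

theorem lieDer_cons (n : ℕ) (x y : g) (u : UniversalEnvelopingAlgebra k g) (v : Fin n → g) :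
    lieDer (n + 1) x u (Fin.cons y v) =
      extMul k g n y (lieDer n x u v) - extMul k g n ⁅x, y⁆ (u ⊗ₜ wedge k n v) := by
  simp only [lieDer, map_sub, map_sum, extMul_wedge, Fin.sum_univ_succ, Fin.cons_zero,
    Fin.cons_succ, Fin.update_cons_zero, ← Fin.cons_update]
  abel

end

theorem koszul_differential_UEA_linear_and_squared_zero
    (k g : Type*) [Field k] [CharZero k] [LieRing g] [LieAlgebra k g]
    (d : ∀ n : ℕ,
      (UniversalEnvelopingAlgebra k g ⊗[k] ⋀[k]^(n + 1) g) →ₗ[k]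
        (UniversalEnvelopingAlgebra k g ⊗[k] ⋀[k]^n g))
    (hd : ∀ (n : ℕ) (u : UniversalEnvelopingAlgebra k g) (v : Fin (n + 1) → g),
      d n (u ⊗ₜ[k] wedge k (n + 1) v) =
        (∑ i : Fin (n + 1),
            ((-1 : k) ^ (i : ℕ)) •
              ((u * UniversalEnvelopingAlgebra.ι k (v i)) ⊗ₜ[k] wedge k n (v ∘ i.succAbove))) +
          ∑ p : Fin (n + 1) × Fin (n + 1),
            if p.1 < p.2 then
              ((-1 : k) ^ ((p.1 : ℕ) + (p.2 : ℕ))) •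
                (u ⊗ₜ[k] wedge k n (consRemove2 ⁅v p.1, v p.2⁆ v p.1 p.2))
            else 0) :
    (∀ (n : ℕ) (a : UniversalEnvelopingAlgebra k g)
        (x : UniversalEnvelopingAlgebra k g ⊗[k] ⋀[k]^(n + 1) g),
        d n (a • x) = a • d n x) ∧
      ∀ n : ℕ, (d n).comp (d (n + 1)) = 0 := by
  refine ⟨?_, ?_⟩
  · intro n a
    refine koszul_induction k g (n + 1) _ ?_ (by simp) ?_
    · intro u v
      rw [TensorProduct.smul_tmul', hd, hd, smul_add, Finset.smul_sum, Finset.smul_sum]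
      have ha : ∀ (u : UniversalEnvelopingAlgebra k g) (w : ⋀[k]^n g),
        a • (u ⊗ₜ[k] w) = (a * u) ⊗ₜ[k] w := fun _ _ => rfl
      congr 1
      · refine Finset.sum_congr rfl fun i _ => ?_
        rw [smul_comm a, ha, smul_eq_mul, mul_assoc]
      · refine Finset.sum_congr rfl fun p _ => ?_
        split_ifs
        · rw [smul_comm a, ha, smul_eq_mul]
        · rw [smul_zero]
    · intro x y hx hy
      rw [smul_add, map_add, hx, hy, map_add, smul_add]
  · intro n
    let θ : ∀ n, g → (UniversalEnvelopingAlgebra k g ⊗[k] ⋀[k]^n g) →ₗ[k]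
        (UniversalEnvelopingAlgebra k g ⊗[k] ⋀[k]^n g) := fun n =>
      match n with
      | 0 => fun x => (d 0).comp (extMul k g 0 x)
      | n + 1 => fun x =>
        (d (n + 1)).comp (extMul k g (n + 1) x) + (extMul k g n x).comp (d n)
    have hθ : ∀ n x u v, θ n x (u ⊗ₜ wedge k n v) = lieDer n x u v := by
      intro n x u v
      cases n with
      | zero => exact koszul_cartan_zero d hd x u v
      | succ n => exact koszul_cartan d hd n x u v
    have hθ0 : ∀ x m, d 0 (extMul k g 0 x m) = θ 0 x m := fun x m => rfl
    have hθ1 : ∀ n x m, d (n + 1) (extMul k g (n + 1) x m) =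
        θ (n + 1) x m - extMul k g n x (d n m) :=
      fun n x m => (add_sub_cancel_right _ _).symm
    clear_value θ
    have h2 : ∀ n x y m, θ (n + 1) x (extMul k g n y m) =
        extMul k g n y (θ n x m) - extMul k g n ⁅x, y⁆ m := by
      intro n x y
      refine koszul_induction k g n _ ?_ (by simp) ?_
      · intro u v
        rw [extMul_wedge, hθ, hθ, lieDer_cons]
      · intro a b ha hb
        simp only [map_add, ha, hb]
        abel
    have h3 : ∀ x y m, θ 0 x (θ 0 y m) = θ 0 y (θ 0 x m) - θ 0 ⁅x, y⁆ m := by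
      intro x y
      refine koszul_induction k g 0 _ ?_ (by simp) ?_
      · intro u v
        have h : ∀ x u, θ 0 x (u ⊗ₜ wedge k 0 v) =
            (u * UniversalEnvelopingAlgebra.ι k x) ⊗ₜ wedge k 0 v := by
          intro x u; rw [hθ]; simp [lieDer]
        rw [h, h, h, h, h, ← TensorProduct.sub_tmul, uea_ι_lie]
        congr 1
        noncomm_ring
      · intro a b ha hb
        simp only [map_add, ha, hb]
        abel
    refine LinearMap.ext fun m => ?_
    refine cartan_sq_zero (fun n => UniversalEnvelopingAlgebra k g ⊗[k] ⋀[k]^n g)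
      (extMul k g) d θ ?_ hθ0 hθ1 h2 h3 ?_ n m
    · intro n x y m
      simp only [extMul, map_add, LinearMap.lTensor_add, LinearMap.add_apply]
    · intro n p hp h0 ha
      refine koszul_induction k g (n + 1) p ?_ h0 ha
      intro u v
      have := hp (v 0) (u ⊗ₜ wedge k n (Fin.tail v))
      rwa [extMul_wedge, Fin.cons_self_tail] at this
end

section
/- Let k be a field of characteristic 0 and g a Lie algebra over k. The augmented complex ⋯ → V₂(g) → V₁(g) → V₀(g) = U(g) →^ε k → 0 is exact; moreover each Vₙ(g) = U(g) ⊗_k ⋀ⁿg is a free (in particular projective) left U(g)-module. Consequently the natural augmentation V•(g) → k exhibits V•(g) as a projective resolution of the trivial left U(g)-module k. -/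
/-!
STATEMENT 3: for a Lie algebra `g` over a field `k` of characteristic `0`, the augmented
Chevalley–Eilenberg–Koszul complex `⋯ → V₂(g) → V₁(g) → V₀(g) = U(g) →^ε k → 0` is exact, and
each `Vₙ(g) = U(g) ⊗ₖ ⋀ⁿg` is a free (in particular projective) left `U(g)`-module; hence the
augmentation exhibits `V•(g)` as a projective resolution of the trivial `U(g)`-module `k`.

Here `ε` is the augmentation (the unique `k`-algebra map with `ε (ι x) = 0`), the differentials
`d n : Vₙ₊₁(g) → Vₙ(g)` are given by the standard formula on the generators `u ⊗ g₁∧⋯∧gₙ`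
(`0`-indexed), and `e : V₀(g) → k` is `ε` composed with the canonical identification
`V₀(g) = U(g) ⊗ₖ ⋀⁰g ≅ U(g)`.
-/

open TensorProduct

set_option synthInstance.maxHeartbeats 1000000
set_option maxHeartbeats 1000000

namespace Koszul

abbrev KU (k g : Type*) [Field k] [LieRing g] [LieAlgebra k g] := UniversalEnvelopingAlgebra k g
abbrev KL (k g : Type*) [Field k] [LieRing g] [LieAlgebra k g] := ExteriorAlgebra k g
abbrev KV (k g : Type*) [Field k] [LieRing g] [LieAlgebra k g] := KU k g ⊗[k] KL k g

section ops

attribute [local instance] LieRing.ofAssociativeRing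

variable (k : Type*) {g : Type*} [Field k] [LieRing g] [LieAlgebra k g]

/-- the canonical map into the enveloping algebra, as a linear map -/
noncomputable def iu : g →ₗ[k] KU k g := (UniversalEnvelopingAlgebra.ι k : g →ₗ⁅k⁆ _)

/-- the canonical map into the exterior algebra -/
noncomputable abbrev il : g →ₗ[k] KL k g := ExteriorAlgebra.ι k

theorem iu_apply (x : g) : iu k x = UniversalEnvelopingAlgebra.ι k x := rfl

theorem iu_lie (x y : g) : iu k ⁅x, y⁆ = iu k x * iu k y - iu k y * iu k x := by
  simp only [iu_apply, LieHom.map_lie, LieRing.of_associative_ring_bracket]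

theorem il_sq (x : g) (w : KL k g) : il k x * (il k x * w) = 0 := by
  rw [← mul_assoc, ExteriorAlgebra.ι_sq_zero, zero_mul]

theorem il_swap (x y : g) : il k x * il k y = - (il k y * il k x) :=
  eq_neg_of_add_eq_zero_left (ExteriorAlgebra.ι_add_mul_swap x y)

theorem il_swap' (x y : g) (w : KL k g) : il k x * (il k y * w) = - (il k y * (il k x * w)) := by
  rw [← mul_assoc, il_swap, neg_mul, mul_assoc]

/-- the step function for the extension of `ad x` to a derivation of the exterior algebra -/
noncomputable def stepL (x : g) : g →ₗ[k] KL k g × KL k g →ₗ[k] KL k g :=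
  LinearMap.mk₂ k (fun y p => il k y * p.2 + il k ⁅x, y⁆ * p.1)
    (fun a b c => by simp [add_mul]; abel)
    (fun a b c => by simp)
    (fun a b c => by simp [mul_add]; abel)
    (fun a b c => by simp)

/-- the derivation of the exterior algebra extending `ad x` -/
noncomputable def LL (x : g) : KL k g →ₗ[k] KL k g :=
  CliffordAlgebra.foldr' 0 (stepL k x) (by
    intro m w fw
    simp only [stepL, LinearMap.mk₂_apply]
    change il k m * (il k m * fw + il k ⁅x, m⁆ * w) + il k ⁅x, m⁆ * (il k m * w) = _
    rw [mul_add, il_sq, il_swap' k m]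
    simp) 0

theorem LL_one (x : g) : LL k x 1 = 0 := by
  have := CliffordAlgebra.foldr'_algebraMap (0 : QuadraticForm k g) (stepL k x) (by
    intro m w fw
    simp only [stepL, LinearMap.mk₂_apply]
    change il k m * (il k m * fw + il k ⁅x, m⁆ * w) + il k ⁅x, m⁆ * (il k m * w) = _
    rw [mul_add, il_sq, il_swap' k m]
    simp) 0 1
  rw [map_one, smul_zero] at this
  exact this

theorem LL_mul (x y : g) (w : KL k g) :
    LL k x (il k y * w) = il k y * LL k x w + il k ⁅x, y⁆ * w :=
  CliffordAlgebra.foldr'_ι_mul (0 : QuadraticForm k g) (stepL k x) _ _ _ _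

/-- left induction on the exterior algebra -/
theorem KL_ind {P : KL k g → Prop} (h1 : P 1) (hs : ∀ (c : k) w, P w → P (c • w))
    (ha : ∀ v w, P v → P w → P (v + w)) (hm : ∀ x w, P w → P (il k x * w)) (w : KL k g) : P w := by
  refine CliffordAlgebra.left_induction (Q := (0 : QuadraticForm k g)) (P := P) ?_ ha ?_ w
  · intro r
    rw [Algebra.algebraMap_eq_smul_one]
    exact hs _ _ h1
  · intro x m h
    exact hm m x h

theorem LL_lie (x y : g) (w : KL k g) :
    LL k ⁅x, y⁆ w = LL k x (LL k y w) - LL k y (LL k x w) := by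
  induction w using KL_ind with
  | h1 => simp [LL_one]
  | hs c w h => simp [h, smul_sub]
  | ha v w hv hw => simp only [map_add, hv, hw]; abel
  | hm z w h =>
    simp only [LL_mul, map_add, h, mul_sub]
    have : il k ⁅⁅x, y⁆, z⁆ = il k ⁅x, ⁅y, z⁆⁆ - il k ⁅y, ⁅x, z⁆⁆ := by
      rw [← map_sub, lie_lie]
    rw [this, sub_mul]
    abel

theorem LL_add (x y : g) (w : KL k g) : LL k (x + y) w = LL k x w + LL k y w := by
  induction w using KL_ind with
  | h1 => simp [LL_one]
  | hs c w h => simp [h]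
  | ha v w hv hw => simp only [map_add, hv, hw]; abel
  | hm z w h =>
    simp only [LL_mul, h, add_lie, map_add, add_mul, mul_add]; abel

theorem LL_smul (c : k) (x : g) (w : KL k g) : LL k (c • x) w = c • LL k x w := by
  induction w using KL_ind with
  | h1 => simp [LL_one]
  | hs c w h => rw [map_smul, map_smul, h, smul_comm]
  | ha v w hv hw => simp only [map_add, hv, hw, smul_add]
  | hm z w h =>
    simp [LL_mul, h]

/-- operators on `V` -/
noncomputable def ee (x : g) : KV k g →ₗ[k] KV k g :=
  LinearMap.lTensor _ (LinearMap.mulLeft k (il k x))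
noncomputable def rr (x : g) : KV k g →ₗ[k] KV k g :=
  LinearMap.rTensor _ (LinearMap.mulRight k (iu k x))
noncomputable def lm (u : KU k g) : KV k g →ₗ[k] KV k g :=
  LinearMap.rTensor _ (LinearMap.mulLeft k u)
noncomputable def lV (x : g) : KV k g →ₗ[k] KV k g :=
  LinearMap.lTensor _ (LL k x)
noncomputable def RR (x : g) : KV k g →ₗ[k] KV k g := rr k x - lV k x

theorem ee_t (x : g) (u : KU k g) (w : KL k g) : ee k x (u ⊗ₜ w) = u ⊗ₜ (il k x * w) := rfl
theorem rr_t (x : g) (u : KU k g) (w : KL k g) : rr k x (u ⊗ₜ w) = (u * iu k x) ⊗ₜ w := rfl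
theorem lm_t (a u : KU k g) (w : KL k g) : lm k a (u ⊗ₜ[k] w) = (a * u) ⊗ₜ w := rfl
theorem lV_t (x : g) (u : KU k g) (w : KL k g) : lV k x (u ⊗ₜ w) = u ⊗ₜ (LL k x w) := rfl
theorem RR_t (x : g) (u : KU k g) (w : KL k g) :
    RR k x (u ⊗ₜ w) = (u * iu k x) ⊗ₜ w - u ⊗ₜ (LL k x w) := rfl

theorem ee_add (x y : g) (v : KV k g) : ee k (x + y) v = ee k x v + ee k y v := by
  induction v using TensorProduct.induction_on with
  | zero => simp
  | tmul u w => simp [ee_t, add_mul, tmul_add]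
  | add a b ha hb => rw [map_add, ha, hb, map_add, map_add]; abel

theorem ee_smul (c : k) (x : g) (v : KV k g) : ee k (c • x) v = c • ee k x v := by
  induction v using TensorProduct.induction_on with
  | zero => simp
  | tmul u w => simp [ee_t]
  | add a b ha hb => rw [map_add, ha, hb, map_add, smul_add]

theorem ee_ee (x : g) (v : KV k g) : ee k x (ee k x v) = 0 := by
  induction v using TensorProduct.induction_on with
  | zero => simp
  | tmul u w => rw [ee_t, ee_t, il_sq, tmul_zero]
  | add a b ha hb => rw [map_add, map_add, ha, hb, add_zero]

theorem ee_lm (x : g) (a : KU k g) (v : KV k g) : ee k x (lm k a v) = lm k a (ee k x v) := by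
  induction v using TensorProduct.induction_on with
  | zero => simp
  | tmul u w => rfl
  | add a b ha hb => simp only [map_add, ha, hb]

/-- step function for the differential on `1 ⊗ Λ` -/
noncomputable def stepD : g →ₗ[k] KL k g × KV k g →ₗ[k] KV k g :=
  LinearMap.mk₂ k (fun y p => iu k y ⊗ₜ p.1 - 1 ⊗ₜ LL k y p.1 - ee k y p.2)
    (fun a b c => by simp only [map_add, add_tmul, LL_add, tmul_add, ee_add]; abel)
    (fun a b c => by
      simp only [map_smul, LL_smul, ee_smul, tmul_smul, smul_sub, ← smul_tmul'])
    (fun a b c => by simp only [Prod.fst_add, Prod.snd_add, tmul_add, map_add]; abel)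
    (fun a b c => by simp only [Prod.smul_fst, Prod.smul_snd, tmul_smul, map_smul, smul_sub])

theorem stepD_cond (m : g) (w : KL k g) (fw : KV k g) :
    stepD k m (il k m * w, stepD k m (w, fw)) = (0 : QuadraticForm k g) m • fw := by
  simp only [stepD, LinearMap.mk₂_apply, map_sub, ee_ee, LL_mul, lie_self, ee_t]
  simp

noncomputable def dL : KL k g →ₗ[k] KV k g :=
  CliffordAlgebra.foldr' 0 (stepD k) (stepD_cond k) 0

theorem dL_one : dL k (1 : KL k g) = 0 := by
  have := CliffordAlgebra.foldr'_algebraMap (0 : QuadraticForm k g) (stepD k) (stepD_cond k) 0 1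
  rw [map_one, smul_zero] at this
  exact this

theorem dL_mul (y : g) (w : KL k g) :
    dL k (il k y * w) = iu k y ⊗ₜ w - 1 ⊗ₜ LL k y w - ee k y (dL k w) :=
  CliffordAlgebra.foldr'_ι_mul (0 : QuadraticForm k g) (stepD k) _ _ _ _

theorem lm_add (a b : KU k g) (v : KV k g) : lm k (a + b) v = lm k a v + lm k b v := by
  induction v using TensorProduct.induction_on with
  | zero => simp
  | tmul u w => simp [lm_t, add_mul, add_tmul]
  | add a b ha hb => rw [map_add, ha, hb, map_add, map_add]; abel

theorem lm_smul (c : k) (a : KU k g) (v : KV k g) : lm k (c • a) v = c • lm k a v := by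
  induction v using TensorProduct.induction_on with
  | zero => simp
  | tmul u w => simp [lm_t, smul_tmul']
  | add a b ha hb => rw [map_add, ha, hb, map_add, smul_add]

/-- the differential -/
noncomputable def dd : KV k g →ₗ[k] KV k g :=
  TensorProduct.lift (LinearMap.mk₂ k (fun u w => lm k u (dL k w))
    (fun a b w => lm_add k a b _) (fun c a w => lm_smul k c a _)
    (fun a v w => by simp only [map_add]) (fun c a w => by simp only [map_smul]))

theorem dd_t (u : KU k g) (w : KL k g) : dd k (u ⊗ₜ w) = lm k u (dL k w) := rfl

theorem dd_one (u : KU k g) : dd k (u ⊗ₜ (1 : KL k g)) = 0 := by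
  rw [dd_t, dL_one, map_zero]

theorem dd_mul (u : KU k g) (y : g) (w : KL k g) :
    dd k (u ⊗ₜ (il k y * w)) = (u * iu k y) ⊗ₜ w - u ⊗ₜ LL k y w - ee k y (dd k (u ⊗ₜ w)) := by
  rw [dd_t, dL_mul, map_sub, map_sub, lm_t, lm_t, mul_one, dd_t, ee_lm]

theorem dd_ee (y : g) (v : KV k g) : dd k (ee k y v) = RR k y v - ee k y (dd k v) := by
  induction v using TensorProduct.induction_on with
  | zero => simp
  | tmul u w => rw [ee_t, dd_mul, RR_t]
  | add a b ha hb => simp only [map_add, ha, hb]; abel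

theorem RR_ee (x y : g) (v : KV k g) :
    RR k x (ee k y v) = ee k y (RR k x v) - ee k ⁅x, y⁆ v := by
  induction v using TensorProduct.induction_on with
  | zero => simp
  | tmul u w => simp only [ee_t, RR_t, LL_mul, map_sub, tmul_add]; abel
  | add a b ha hb => simp only [map_add, ha, hb]; abel

theorem RR_lie (x y : g) (v : KV k g) :
    RR k ⁅x, y⁆ v = RR k y (RR k x v) - RR k x (RR k y v) := by
  induction v using TensorProduct.induction_on with
  | zero => simp
  | tmul u w =>
    simp only [RR_t, map_sub, LL_lie, iu_lie, mul_sub, sub_tmul, tmul_sub, mul_assoc]; abel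
  | add a b ha hb => simp only [map_add, ha, hb]; abel

/-- induction on `V` -/
theorem KV_ind {P : KV k g → Prop} (h1 : ∀ u : KU k g, P (u ⊗ₜ 1))
    (ha : ∀ v w, P v → P w → P (v + w)) (hm : ∀ x v, P v → P (ee k x v)) (v : KV k g) : P v := by
  induction v using TensorProduct.induction_on with
  | zero => simpa using h1 0
  | add a b h h' => exact ha _ _ h h'
  | tmul u w =>
    induction w using KL_ind generalizing u with
    | h1 => exact h1 u
    | hs c w h => rw [tmul_smul, smul_tmul']; exact h _
    | ha v w hv hw => rw [tmul_add]; exact ha _ _ (hv u) (hw u)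
    | hm x w h => exact hm x _ (h u)

theorem dd_RR (x : g) (v : KV k g) : dd k (RR k x v) = RR k x (dd k v) := by
  induction v using KV_ind with
  | h1 u => simp [RR_t, LL_one, dd_one]
  | ha v w hv hw => simp only [map_add, hv, hw]
  | hm y v h =>
    rw [RR_ee, map_sub, dd_ee, dd_ee, dd_ee, h, map_sub, RR_ee, RR_lie]
    abel

theorem dd_dd (v : KV k g) : dd k (dd k v) = 0 := by
  induction v using KV_ind with
  | h1 u => simp [dd_one]
  | ha v w hv hw => simp only [map_add, hv, hw, add_zero]
  | hm y v h =>
    rw [dd_ee, map_sub, dd_RR, dd_ee, h, map_zero, sub_zero, sub_self]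

end ops

section filt

attribute [local instance] LieRing.ofAssociativeRing

variable (k : Type*) {g : Type*} [Field k] [LieRing g] [LieAlgebra k g]

theorem map2_ind {M N Q : Type*} [AddCommGroup M] [AddCommGroup N] [AddCommGroup Q]
    [Module k M] [Module k N] [Module k Q] (f : M →ₗ[k] N →ₗ[k] Q) {p : Submodule k M}
    {q : Submodule k N} {P : Q → Prop} (ha : ∀ u v, P u → P v → P (u + v))
    (h0 : P 0) (hm : ∀ u ∈ p, ∀ v ∈ q, P (f u v)) (t) (ht : t ∈ Submodule.map₂ f p q) : P t := by
  refine Submodule.iSup_induction _ (motive := P) ht ?_ h0 ha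
  rintro ⟨u, hu⟩ x ⟨v, hv, rfl⟩
  exact hm u hu v hv

/-- the filtration of the enveloping algebra, `Fil p` is the part of degree `< p` -/
noncomputable def Fil : ℕ → Submodule k (KU k g)
  | 0 => ⊥
  | p + 1 => (1 ⊔ LinearMap.range (iu k)) ^ p

theorem Fil_succ (p : ℕ) : Fil k (g := g) (p + 1) = (1 ⊔ LinearMap.range (iu k)) ^ p := rfl

theorem Fil_le (p : ℕ) : Fil k (g := g) p ≤ Fil k (p + 1) := by
  cases p with
  | zero => exact bot_le
  | succ p =>
    rw [Fil_succ, Fil_succ, pow_succ]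
    intro x hx
    rw [← mul_one x]
    exact Submodule.mul_mem_mul hx (le_sup_left (a := (1 : Submodule k (KU k g))) (Submodule.mem_one.2 ⟨1, map_one _⟩))

theorem Fil_mul {p : ℕ} {u : KU k g} (hu : u ∈ Fil k p) (y : g) : u * iu k y ∈ Fil k (p + 1) := by
  cases p with
  | zero =>
    rw [(Submodule.mem_bot k).1 hu, zero_mul]
    exact zero_mem _
  | succ p =>
    rw [Fil_succ, pow_succ]
    exact Submodule.mul_mem_mul hu (le_sup_right (a := (1 : Submodule k (KU k g))) ⟨y, rfl⟩)

theorem Fil_ind {p : ℕ} {P : KU k g → Prop} (ha : ∀ u v, P u → P v → P (u + v))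
    (h1 : ∀ u ∈ Fil k (p + 1), P u) (hm : ∀ u ∈ Fil k (p + 1), ∀ y, P (u * iu k y))
    (u : KU k g) (hu : u ∈ Fil k (p + 2)) : P u := by
  rw [Fil_succ, pow_succ] at hu
  refine Submodule.mul_induction_on hu ?_ ha
  intro a ha' b hb
  obtain ⟨c, hc, d, ⟨y, rfl⟩, rfl⟩ := Submodule.mem_sup.1 hb
  obtain ⟨c, rfl⟩ := Submodule.mem_one.1 hc
  rw [mul_add]
  refine ha _ _ (h1 _ ?_) (hm a ha' y)
  rw [Algebra.algebraMap_eq_smul_one, mul_smul_comm, mul_one]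
  exact Submodule.smul_mem _ _ ha'

theorem KU_ind {P : KU k g → Prop} (h1 : ∀ c : k, P (algebraMap k _ c)) (hi : ∀ x, P (iu k x))
    (ha : ∀ u v, P u → P v → P (u + v)) (hm : ∀ u v, P u → P v → P (u * v)) (u : KU k g) : P u := by
  let S : Subalgebra k (KU k g) :=
    { carrier := {u | P u}
      mul_mem' := fun {a b} h h' => hm a b h h'
      add_mem' := fun {a b} h h' => ha a b h h'
      algebraMap_mem' := h1 }
  let f : g →ₗ⁅k⁆ S :=
    { toFun := fun x => ⟨iu k x, hi x⟩
      map_add' := fun x y => Subtype.ext (map_add _ _ _)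
      map_smul' := fun c x => Subtype.ext (map_smul _ _ _)
      map_lie' := fun {x y} => Subtype.ext (iu_lie k x y) }
  have h : S.val.comp (UniversalEnvelopingAlgebra.lift k f) = AlgHom.id k _ := by
    apply UniversalEnvelopingAlgebra.hom_ext
    ext x
    change S.val (UniversalEnvelopingAlgebra.lift k f (UniversalEnvelopingAlgebra.ι k x)) = _
    rw [UniversalEnvelopingAlgebra.lift_ι_apply]
    rfl
  have h2 : S.val (UniversalEnvelopingAlgebra.lift k f u) = u := DFunLike.congr_fun h u
  rw [← h2]
  exact (UniversalEnvelopingAlgebra.lift k f u).2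

theorem Fil_mono {p q : ℕ} (h : p ≤ q) : Fil k (g := g) p ≤ Fil k q := by
  induction q, h using Nat.le_induction with
  | base => exact le_rfl
  | succ q _ ih => exact ih.trans (Fil_le k q)

theorem Fil_exhaust (u : KU k g) : ∃ p, u ∈ Fil k (p + 1) := by
  induction u using KU_ind with
  | h1 c => exact ⟨0, by rw [Fil_succ, pow_zero]; exact Submodule.mem_one.2 ⟨c, rfl⟩⟩
  | hi x =>
    refine ⟨1, ?_⟩
    rw [← one_mul (iu k x)]
    exact Fil_mul k (by rw [Fil_succ, pow_zero]; exact (Submodule.mem_one.2 ⟨1, map_one _⟩)) x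
  | ha u v hu hv =>
    obtain ⟨p, hp⟩ := hu
    obtain ⟨q, hq⟩ := hv
    exact ⟨p + q, add_mem (Fil_mono k (by omega) hp) (Fil_mono k (by omega) hq)⟩
  | hm u v hu hv =>
    obtain ⟨p, hp⟩ := hu
    obtain ⟨q, hq⟩ := hv
    refine ⟨p + q, ?_⟩
    rw [Fil_succ, pow_add]
    exact Submodule.mul_mem_mul hp hq

/-- comultiplication -/
noncomputable def Del : KU k g →ₐ[k] KU k g ⊗[k] KU k g :=
  UniversalEnvelopingAlgebra.lift k
    { toFun := fun x => iu k x ⊗ₜ 1 + 1 ⊗ₜ iu k x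
      map_add' := fun x y => by simp only [map_add, add_tmul, tmul_add]; abel
      map_smul' := fun c x => by simp [smul_tmul']
      map_lie' := fun {x y} => by
        simp only [LieRing.of_associative_ring_bracket, mul_add, add_mul,
          Algebra.TensorProduct.tmul_mul_tmul, one_mul, mul_one, iu_lie, sub_tmul, tmul_sub]
        abel }

theorem Del_iu (x : g) : Del k (iu k x) = iu k x ⊗ₜ 1 + 1 ⊗ₜ iu k x := by
  rw [iu_apply, Del, UniversalEnvelopingAlgebra.lift_ι_apply]
  rfl

/-- `Fil p ⊗ U` -/
noncomputable def FU (p : ℕ) : Submodule k (KU k g ⊗[k] KU k g) :=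
  Submodule.map₂ (TensorProduct.mk k _ _) (Fil k p) ⊤

theorem FU_ind {p : ℕ} {P : KU k g ⊗[k] KU k g → Prop} (ha : ∀ u v, P u → P v → P (u + v))
    (h0 : P 0) (hm : ∀ u ∈ Fil k p, ∀ v, P (u ⊗ₜ v)) (t) (ht : t ∈ FU k (g := g) p) : P t := by
  exact map2_ind k _ ha h0 (fun u hu v _ => hm u hu v) t ht

theorem Del_sub {p : ℕ} (u : KU k g) (hu : u ∈ Fil k (p + 1)) : Del k u - u ⊗ₜ 1 ∈ FU k p := by
  induction p generalizing u with
  | zero =>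
    rw [Fil_succ, pow_zero] at hu
    obtain ⟨c, rfl⟩ := Submodule.mem_one.1 hu
    rw [AlgHom.commutes, Algebra.TensorProduct.algebraMap_apply, sub_self]
    exact zero_mem _
  | succ p ih =>
    have mono : FU k (g := g) p ≤ FU k (p + 1) := Submodule.map₂_le_map₂_left (Fil_le k p)
    refine Fil_ind k (P := fun u => Del k u - u ⊗ₜ 1 ∈ FU k (p + 1)) ?_ ?_ ?_ u hu
    · intro a b ha hb
      rw [map_add, add_tmul, add_sub_add_comm]
      exact add_mem ha hb
    · intro a ha
      exact mono (ih a ha)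
    · intro a ha y
      have : Del k (a * iu k y) - (a * iu k y) ⊗ₜ 1 =
          (Del k a - a ⊗ₜ 1) * (iu k y ⊗ₜ 1) + (Del k a - a ⊗ₜ 1) * (1 ⊗ₜ iu k y) + a ⊗ₜ iu k y := by
        rw [map_mul, Del_iu]
        simp only [sub_mul, mul_add, Algebra.TensorProduct.tmul_mul_tmul, one_mul, mul_one]
        abel
      rw [this]
      refine add_mem (add_mem ?_ ?_) ?_
      · refine FU_ind k (P := fun t => t * (iu k y ⊗ₜ 1) ∈ FU k (p + 1)) ?_ ?_ ?_ _ (ih a ha)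
        · intro u v hu hv
          rw [add_mul]; exact add_mem hu hv
        · rw [zero_mul]; exact zero_mem _
        · intro u hu v
          rw [Algebra.TensorProduct.tmul_mul_tmul]
          exact Submodule.apply_mem_map₂ _ (Fil_mul k hu y) trivial
      · refine FU_ind k (P := fun t => t * (1 ⊗ₜ iu k y) ∈ FU k (p + 1)) ?_ ?_ ?_ _ (ih a ha)
        · intro u v hu hv
          rw [add_mul]; exact add_mem hu hv
        · rw [zero_mul]; exact zero_mem _
        · intro u hu v
          rw [Algebra.TensorProduct.tmul_mul_tmul, mul_one]
          exact Submodule.apply_mem_map₂ _ (Fil_le k _ hu) trivial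
      · exact Submodule.apply_mem_map₂ _ ha trivial

variable (D : KU k g →ₗ[k] g)

/-- `a ⊗ b ↦ a * D b` -/
noncomputable def mu : KU k g ⊗[k] KU k g →ₗ[k] KU k g :=
  LinearMap.mul' k _ ∘ₗ LinearMap.lTensor _ (iu k ∘ₗ D)

theorem mu_t (a b : KU k g) : mu k D (a ⊗ₜ b) = a * iu k (D b) := rfl

/-- `a ⊗ b ↦ a * ⁅D b, y⁆` -/
noncomputable def nu (y : g) : KU k g ⊗[k] KU k g →ₗ[k] KU k g :=
  LinearMap.mul' k _ ∘ₗ LinearMap.lTensor _ (iu k ∘ₗ LieAlgebra.ad k g y ∘ₗ D)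

theorem nu_t (y : g) (a b : KU k g) : nu k D y (a ⊗ₜ b) = a * iu k ⁅y, D b⁆ := rfl

theorem mu_FU {p : ℕ} (t) (ht : t ∈ FU k (g := g) p) : mu k D t ∈ Fil k (p + 1) := by
  refine FU_ind k (P := fun t => mu k D t ∈ Fil k (p + 1)) ?_ ?_ ?_ t ht
  · intro u v hu hv
    rw [map_add]; exact add_mem hu hv
  · rw [map_zero]; exact zero_mem _
  · intro u hu v
    exact Fil_mul k hu _

theorem nu_FU {p : ℕ} (y : g) (t) (ht : t ∈ FU k (g := g) p) : nu k D y t ∈ Fil k (p + 1) := by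
  refine FU_ind k (P := fun t => nu k D y t ∈ Fil k (p + 1)) ?_ ?_ ?_ t ht
  · intro u v hu hv
    rw [map_add]; exact add_mem hu hv
  · rw [map_zero]; exact zero_mem _
  · intro u hu v
    exact Fil_mul k hu _

theorem FU_mul_right {p : ℕ} (y : g) (t) (ht : t ∈ FU k (g := g) p) :
    t * (1 ⊗ₜ iu k y) ∈ FU k p := by
  refine FU_ind k (P := fun t => t * (1 ⊗ₜ iu k y) ∈ FU k p) ?_ ?_ ?_ _ ht
  · intro u v hu hv
    rw [add_mul]; exact add_mem hu hv
  · rw [zero_mul]; exact zero_mem _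
  · intro u hu v
    rw [Algebra.TensorProduct.tmul_mul_tmul, mul_one]
    exact Submodule.apply_mem_map₂ _ hu trivial

theorem mu_mul (y : g) (t : KU k g ⊗[k] KU k g) :
    mu k D (t * (iu k y ⊗ₜ 1)) = mu k D t * iu k y + nu k D y t := by
  induction t using TensorProduct.induction_on with
  | zero => simp
  | tmul a b =>
    rw [Algebra.TensorProduct.tmul_mul_tmul, mu_t, mu_t, nu_t, mul_one, iu_lie]
    simp only [mul_sub, mul_assoc]; abel
  | add a b ha hb => simp only [add_mul, map_add, ha, hb]; abel

variable {D}

theorem mu_Del (hD : ∀ x, D (iu k x) = x) (hD1 : D 1 = 0) {p : ℕ} (u : KU k g) (hu : u ∈ Fil k (p + 1)) :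
    mu k D (Del k u) - (p : k) • u ∈ Fil k p := by
  induction p generalizing u with
  | zero =>
    rw [Fil_succ, pow_zero] at hu
    obtain ⟨c, rfl⟩ := Submodule.mem_one.1 hu
    rw [AlgHom.commutes, Algebra.TensorProduct.algebraMap_apply, mu_t, hD1]
    simp
  | succ p ih =>
    refine Fil_ind k (P := fun u => mu k D (Del k u) - ((p + 1 : ℕ) : k) • u ∈ Fil k (p + 1))
      ?_ ?_ ?_ u hu
    · intro a b ha hb
      rw [map_add, map_add, smul_add, add_sub_add_comm]
      exact add_mem ha hb
    · intro a ha
      have := Fil_le k _ (ih a ha)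
      have h2 := sub_mem this ha
      convert h2 using 1
      push_cast
      rw [add_smul, one_smul]
      abel
    · intro a ha y
      have h0 := Del_sub k a ha
      have e1 : Del k a = a ⊗ₜ 1 + (Del k a - a ⊗ₜ 1) := by abel
      have : mu k D (Del k (a * iu k y)) - ((p + 1 : ℕ) : k) • (a * iu k y) =
          (mu k D (Del k a) - (p : k) • a) * iu k y + nu k D y (Del k a - a ⊗ₜ 1)
            + mu k D ((Del k a - a ⊗ₜ 1) * (1 ⊗ₜ iu k y)) := by
        rw [map_mul, Del_iu, mul_add, map_add, mu_mul, map_sub (nu k D y), nu_t, hD1, sub_mul,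
          sub_mul, map_sub, Algebra.TensorProduct.tmul_mul_tmul, mu_t, mul_one, one_mul, hD]
        push_cast
        rw [add_smul, one_smul, lie_zero, map_zero, mul_zero, smul_mul_assoc]
        abel
      rw [this]
      exact add_mem (add_mem (Fil_mul k (ih a ha) y) (nu_FU k D y _ h0))
        (mu_FU k D _ (FU_mul_right k y _ h0))

end filt

section homotopy

variable (k : Type*) {g : Type*} [Field k] [LieRing g] [LieAlgebra k g]

/-- exterior powers, as submodules -/
noncomputable abbrev Ep (n : ℕ) : Submodule k (KL k g) := ⋀[k]^n g

theorem Ep_succ_ind {n : ℕ} {P : KL k g → Prop} (ha : ∀ u v, P u → P v → P (u + v))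
    (hm : ∀ y : g, ∀ w ∈ Ep k n, P (il k y * w)) (w) (hw : w ∈ Ep k (g := g) (n + 1)) : P w := by
  change w ∈ LinearMap.range (il k) ^ (n + 1) at hw
  rw [pow_succ'] at hw
  refine Submodule.mul_induction_on hw ?_ ha
  rintro _ ⟨y, rfl⟩ w hw
  exact hm y w hw

theorem Ep_mul {n : ℕ} (y : g) {w : KL k g} (hw : w ∈ Ep k n) : il k y * w ∈ Ep k (n + 1) := by
  change _ ∈ LinearMap.range (il k) ^ (n + 1)
  rw [pow_succ']
  exact Submodule.mul_mem_mul ⟨y, rfl⟩ hw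

theorem Ep_zero (w : KL k g) (hw : w ∈ Ep k 0) : ∃ c : k, w = c • 1 := by
  change w ∈ LinearMap.range (il k) ^ 0 at hw
  rw [pow_zero] at hw
  obtain ⟨c, rfl⟩ := Submodule.mem_one.1 hw
  exact ⟨c, Algebra.algebraMap_eq_smul_one c⟩

theorem LL_mem {n : ℕ} (x : g) (w : KL k g) (hw : w ∈ Ep k n) : LL k x w ∈ Ep k n := by
  induction n generalizing w with
  | zero =>
    obtain ⟨c, rfl⟩ := Ep_zero k w hw
    rw [map_smul, LL_one, smul_zero]
    exact zero_mem _
  | succ n ih =>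
    refine Ep_succ_ind k (P := fun w => LL k x w ∈ Ep k (n + 1)) ?_ ?_ w hw
    · intro u v hu hv
      rw [map_add]; exact add_mem hu hv
    · intro y w hw
      rw [LL_mul]
      exact add_mem (Ep_mul k y (ih w hw)) (Ep_mul k _ hw)

/-- the filtration on `V` -/
noncomputable def FV (p n : ℕ) : Submodule k (KV k g) :=
  Submodule.map₂ (TensorProduct.mk k _ _) (Fil k p) (Ep k n)

theorem FV_mem {p n : ℕ} {u : KU k g} {w : KL k g} (hu : u ∈ Fil k p) (hw : w ∈ Ep k n) :
    u ⊗ₜ w ∈ FV k p n := Submodule.apply_mem_map₂ (TensorProduct.mk k _ _) hu hw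

theorem FV_map {p n p' n' : ℕ} (f : KV k g →ₗ[k] KV k g)
    (h : ∀ u ∈ Fil k p, ∀ w ∈ Ep k n, f (u ⊗ₜ w) ∈ FV k p' n') (v) (hv : v ∈ FV k p n) :
    f v ∈ FV k p' n' := by
  have : FV k p n ≤ (FV k p' n').comap f := Submodule.map₂_le.2 h
  exact this hv

theorem ee_FV {p n : ℕ} (y : g) (v) (hv : v ∈ FV k p n) : ee k y v ∈ FV k p (n + 1) :=
  FV_map k _ (fun _ hu _ hw => FV_mem k hu (Ep_mul k y hw)) v hv

theorem lV_FV {p n : ℕ} (y : g) (v) (hv : v ∈ FV k p n) : lV k y v ∈ FV k p n :=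
  FV_map k _ (fun _ hu _ hw => FV_mem k hu (LL_mem k y _ hw)) v hv

variable (D : KU k g →ₗ[k] g)

/-- `w ↦ (b ↦ D b ∧ w)` -/
noncomputable def mB : KL k g →ₗ[k] KU k g →ₗ[k] KL k g :=
  (LinearMap.mul k (KL k g) ∘ₗ il k ∘ₗ D).flip

theorem mB_apply (w : KL k g) (b : KU k g) : mB k D w b = il k (D b) * w := rfl

noncomputable def hT (w : KL k g) : KU k g ⊗[k] KU k g →ₗ[k] KV k g :=
  LinearMap.lTensor _ (mB k D w)

theorem hT_t (w : KL k g) (a b : KU k g) : hT k D w (a ⊗ₜ b) = a ⊗ₜ (il k (D b) * w) := rfl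

/-- the homotopy -/
noncomputable def hh : KV k g →ₗ[k] KV k g :=
  TensorProduct.lift (LinearMap.mk₂ k (fun u w => hT k D w (Del k u))
    (fun a b w => by simp only [map_add]) (fun c a w => by simp only [map_smul])
    (fun a v w => by simp only [hT, map_add, LinearMap.lTensor_add, LinearMap.add_apply])
    (fun c a w => by simp only [hT, map_smul, LinearMap.lTensor_smul, LinearMap.smul_apply]))

theorem hh_t (u : KU k g) (w : KL k g) : hh k D (u ⊗ₜ w) = hT k D w (Del k u) := rfl

theorem hT_ee (y : g) (w : KL k g) (t) : hT k D (il k y * w) t = - ee k y (hT k D w t) := by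
  induction t using TensorProduct.induction_on with
  | zero => simp
  | tmul a b => rw [hT_t, hT_t, ee_t, il_swap', tmul_neg]
  | add a b ha hb => simp only [map_add, ha, hb, neg_add]

theorem hh_ee (y : g) (v) : hh k D (ee k y v) = - ee k y (hh k D v) := by
  induction v using TensorProduct.induction_on with
  | zero => simp
  | tmul a b => rw [ee_t, hh_t, hh_t, hT_ee]
  | add a b ha hb => simp only [map_add, ha, hb, neg_add]

theorem hT_rr (y : g) (w : KL k g) (t) :
    rr k y (hT k D w t) = hT k D w (t * (iu k y ⊗ₜ 1)) := by
  induction t using TensorProduct.induction_on with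
  | zero => simp
  | tmul a b => rw [hT_t, Algebra.TensorProduct.tmul_mul_tmul, rr_t, hT_t, mul_one]
  | add a b ha hb => simp only [map_add, add_mul, ha, hb]

theorem dd_hT (t) : dd k (hT k D 1 t) = mu k D t ⊗ₜ 1 := by
  induction t using TensorProduct.induction_on with
  | zero => simp
  | tmul a b => rw [hT_t, mu_t, dd_mul, LL_one, dd_one]; simp
  | add a b ha hb => simp only [map_add, add_tmul, ha, hb]

theorem hT_FU {p n : ℕ} (w : KL k g) (hw : w ∈ Ep k n) (t) (ht : t ∈ FU k (g := g) p) :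
    hT k D w t ∈ FV k p (n + 1) := by
  have : FU k (g := g) p ≤ (FV k p (n + 1)).comap (hT k D w) :=
    Submodule.map₂_le.2 fun u hu v _ => FV_mem k hu (Ep_mul k _ hw)
  exact this ht

variable {D}

theorem hh_FV (hD1 : D 1 = 0) {p n : ℕ} (v) (hv : v ∈ FV k (p + 1) n) :
    hh k D v ∈ FV k p (n + 1) := by
  refine FV_map k _ ?_ v hv
  intro u hu w hw
  have h := hT_FU k D w hw _ (Del_sub k u hu)
  rw [map_sub, hT_t, hD1, map_zero, zero_mul, tmul_zero, sub_zero] at h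
  exact h

theorem hh_rr (hD : ∀ x, D (iu k x) = x) {p n : ℕ} (y : g) (u : KU k g) (hu : u ∈ Fil k (p + 1))
    (w : KL k g) (hw : w ∈ Ep k n) :
    hh k D (rr k y (u ⊗ₜ w)) - rr k y (hh k D (u ⊗ₜ w)) - ee k y (u ⊗ₜ w) ∈ FV k p (n + 1) := by
  have h := hT_FU k D w hw _ (FU_mul_right k y _ (Del_sub k u hu))
  convert h using 1
  rw [rr_t, hh_t, hh_t, hT_rr, map_mul, Del_iu, mul_add, map_add, sub_mul, map_sub,
    Algebra.TensorProduct.tmul_mul_tmul, hT_t, mul_one, one_mul, hD, ee_t]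
  abel

theorem homotopy_tmul (hD : ∀ x, D (iu k x) = x) (hD1 : D 1 = 0) {p n : ℕ} (u : KU k g)
    (hu : u ∈ Fil k (p + 1)) (w : KL k g) (hw : w ∈ Ep k n) :
    dd k (hh k D (u ⊗ₜ w)) + hh k D (dd k (u ⊗ₜ w)) - ((p + n : ℕ) : k) • (u ⊗ₜ w) ∈ FV k p n := by
  induction n generalizing w with
  | zero =>
    obtain ⟨c, rfl⟩ := Ep_zero k w hw
    have h1 : (1 : KL k g) ∈ Ep k 0 := by
      change _ ∈ LinearMap.range (il k) ^ 0
      rw [pow_zero]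
      exact Submodule.mem_one.2 ⟨1, map_one _⟩
    have := FV_mem k (mu_Del k hD hD1 u hu) h1
    have h2 := Submodule.smul_mem _ c this
    convert h2 using 1
    simp only [tmul_smul, map_smul, dd_one, map_zero, add_zero, smul_zero, sub_tmul, hh_t, dd_hT,
      smul_sub, smul_tmul']
    rw [smul_comm]
  | succ n ih =>
    refine Ep_succ_ind k (P := fun w => dd k (hh k D (u ⊗ₜ w)) + hh k D (dd k (u ⊗ₜ w)) -
      ((p + (n + 1) : ℕ) : k) • (u ⊗ₜ w) ∈ FV k p (n + 1)) ?_ ?_ w hw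
    · intro a b ha hb
      convert add_mem ha hb using 1
      simp only [tmul_add, map_add, smul_add]
      abel
    · intro y v hv
      rw [← ee_t]
      have h1 := ee_FV k y _ (ih v hv)
      have h2 := hh_rr k hD y u hu v hv
      have h3 := hh_FV k hD1 _ (lV_FV k y _ (FV_mem k hu hv))
      have h4 := lV_FV k y _ (hh_FV k hD1 _ (FV_mem k hu hv))
      convert add_mem (sub_mem (add_mem h1 h2) h3) h4 using 1
      rw [hh_ee, map_neg, dd_ee, dd_ee, map_sub, hh_ee]
      simp only [RR, LinearMap.sub_apply, map_sub, map_add, map_smul]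
      push_cast
      simp only [add_smul, one_smul]
      abel

theorem homotopy (hD : ∀ x, D (iu k x) = x) (hD1 : D 1 = 0) {p n : ℕ} (v : KV k g)
    (hv : v ∈ FV k (p + 1) n) :
    dd k (hh k D v) + hh k D (dd k v) - ((p + n : ℕ) : k) • v ∈ FV k p n :=
  FV_map k (dd k ∘ₗ hh k D + hh k D ∘ₗ dd k - ((p + n : ℕ) : k) • LinearMap.id)
    (fun u hu w hw => homotopy_tmul k hD hD1 u hu w hw) v hv

/-- all of `V_n` -/
noncomputable def VV (n : ℕ) : Submodule k (KV k g) :=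
  Submodule.map₂ (TensorProduct.mk k _ _) ⊤ (Ep k n)

theorem FV_le (p n : ℕ) : FV k (g := g) p n ≤ VV k n := Submodule.map₂_le_map₂_left le_top

theorem VV_exhaust {n : ℕ} (v) (hv : v ∈ VV k (g := g) n) : ∃ p, v ∈ FV k p n := by
  refine map2_ind k _ (P := fun v => ∃ p, v ∈ FV k p n) ?_ ⟨0, zero_mem _⟩ ?_ v hv
  · rintro a b ⟨p, hp⟩ ⟨q, hq⟩
    refine ⟨p + q, add_mem ?_ ?_⟩
    · exact Submodule.map₂_le_map₂_left (Fil_mono k (by omega)) hp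
    · exact Submodule.map₂_le_map₂_left (Fil_mono k (by omega)) hq
  · intro u _ w hw
    obtain ⟨p, hp⟩ := Fil_exhaust k u
    exact ⟨p + 1, FV_mem k hp hw⟩

theorem exact_FV [CharZero k] (hD : ∀ x, D (iu k x) = x) (hD1 : D 1 = 0)
    (ε : KV k g →ₗ[k] k) (hε : ∀ v, ε (dd k v) = 0) (hε1 : ε (1 ⊗ₜ 1) = 1)
    (p n : ℕ) (v : KV k g) (hv : v ∈ FV k p n) (hdv : dd k v = 0) (hεv : ε v = 0) :
    ∃ y ∈ VV k (n + 1), dd k y = v := by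
  induction p generalizing v with
  | zero =>
    rw [FV, Fil, Submodule.map₂_bot_left, Submodule.mem_bot] at hv
    exact ⟨0, zero_mem _, by rw [hv, map_zero]⟩
  | succ p ih =>
    by_cases hpn : p + n = 0
    · obtain ⟨rfl, rfl⟩ : p = 0 ∧ n = 0 := by omega
      have : ∃ c : k, v = c • (1 ⊗ₜ 1) := by
        refine map2_ind k _ (P := fun v => ∃ c : k, v = c • (1 ⊗ₜ 1)) ?_ ⟨0, by simp⟩ ?_ v hv
        · rintro a b ⟨c, rfl⟩ ⟨c', rfl⟩
          exact ⟨c + c', by rw [add_smul]⟩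
        · intro u hu w hw
          rw [Fil_succ, pow_zero] at hu
          obtain ⟨c, rfl⟩ := Submodule.mem_one.1 hu
          obtain ⟨c', rfl⟩ := Ep_zero k w hw
          refine ⟨c' * c, ?_⟩
          rw [Algebra.algebraMap_eq_smul_one, mul_smul]
          simp [smul_tmul']
      obtain ⟨c, rfl⟩ := this
      rw [map_smul, hε1, smul_eq_mul, mul_one] at hεv
      exact ⟨0, zero_mem _, by rw [hεv]; simp⟩
    · have hN : ((p + n : ℕ) : k) ≠ 0 := Nat.cast_ne_zero.2 hpn
      have h := homotopy k hD hD1 v hv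
      rw [hdv, map_zero, add_zero] at h
      have h2 := Submodule.smul_mem _ (-((p + n : ℕ) : k)⁻¹) h
      have h3 : -((p + n : ℕ) : k)⁻¹ • (dd k (hh k D v) - ((p + n : ℕ) : k) • v) =
          v - dd k (((p + n : ℕ) : k)⁻¹ • hh k D v) := by
        rw [smul_sub, smul_smul, neg_mul, inv_mul_cancel₀ hN, map_smul]
        simp only [neg_smul, one_smul]
        abel
      rw [h3] at h2
      obtain ⟨y, hy, hyv⟩ := ih _ h2 (by rw [map_sub, dd_dd, hdv, sub_zero])
        (by rw [map_sub, hε, hεv, sub_zero])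
      refine ⟨y + ((p + n : ℕ) : k)⁻¹ • hh k D v, add_mem hy (Submodule.smul_mem _ _ ?_), ?_⟩
      · exact FV_le k _ _ (hh_FV k hD1 v hv)
      · rw [map_add, hyv]; abel

end homotopy

section aug

attribute [local instance] LieRing.ofAssociativeRing

variable (k : Type*) {g : Type*} [Field k] [LieRing g] [LieAlgebra k g]

/-- the augmentation of the enveloping algebra -/
noncomputable def eps0 : KU k g →ₐ[k] k := UniversalEnvelopingAlgebra.lift k (0 : g →ₗ⁅k⁆ k)

theorem eps0_iu (x : g) : eps0 k (iu k x) = 0 := by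
  rw [iu_apply, eps0, UniversalEnvelopingAlgebra.lift_ι_apply]
  rfl

theorem inv_il (x : g) (w : KL k g) : ExteriorAlgebra.algebraMapInv (il k x * w) = (0 : k) := by
  rw [map_mul, ExteriorAlgebra.algebraMapInv, ExteriorAlgebra.lift_ι_apply]
  simp

theorem inv_LL (x : g) (w : KL k g) : ExteriorAlgebra.algebraMapInv (LL k x w) = (0 : k) := by
  induction w using KL_ind with
  | h1 => rw [LL_one, map_zero]
  | hs c w h => rw [map_smul, map_smul, h, smul_zero]
  | ha v w hv hw => rw [map_add, map_add, hv, hw, add_zero]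
  | hm z w h => rw [LL_mul, map_add, inv_il, inv_il, add_zero]

/-- the augmentation of the whole complex -/
noncomputable def epsV : KV k g →ₗ[k] k :=
  LinearMap.mul' k k ∘ₗ TensorProduct.map (eps0 k).toLinearMap
    (ExteriorAlgebra.algebraMapInv (R := k) (M := g)).toLinearMap

theorem epsV_t (u : KU k g) (w : KL k g) :
    epsV k (u ⊗ₜ w) = eps0 k u * ExteriorAlgebra.algebraMapInv w := rfl

theorem epsV_one : epsV k ((1 : KU k g) ⊗ₜ (1 : KL k g)) = 1 := by
  rw [epsV_t, map_one, map_one, mul_one]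

theorem epsV_ee (x : g) (v : KV k g) : epsV k (ee k x v) = 0 := by
  induction v using TensorProduct.induction_on with
  | zero => simp
  | tmul u w => rw [ee_t, epsV_t, inv_il, mul_zero]
  | add a b ha hb => rw [map_add, map_add, ha, hb, add_zero]

theorem epsV_RR (x : g) (v : KV k g) : epsV k (RR k x v) = 0 := by
  induction v using TensorProduct.induction_on with
  | zero => simp
  | tmul u w =>
    rw [RR_t, map_sub, epsV_t, epsV_t, inv_LL, mul_zero, map_mul, eps0_iu, mul_zero, zero_mul,
      sub_zero]
  | add a b ha hb => rw [map_add, map_add, ha, hb, add_zero]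

theorem epsV_dd (v : KV k g) : epsV k (dd k v) = 0 := by
  induction v using KV_ind with
  | h1 u => rw [dd_one, map_zero]
  | ha v w hv hw => rw [map_add, map_add, hv, hw, add_zero]
  | hm x v h => rw [dd_ee, map_sub, epsV_RR, epsV_ee, sub_zero]

theorem epsV_VV (n : ℕ) (v : KV k g) (hv : v ∈ VV k (n + 1)) : epsV k v = 0 := by
  refine map2_ind k _ (P := fun v => epsV k v = 0) ?_ (map_zero _) ?_ v hv
  · intro a b ha hb
    rw [map_add, ha, hb, add_zero]
  · intro u _ w hw
    refine Ep_succ_ind k (P := fun w => epsV k (u ⊗ₜ w) = 0) ?_ ?_ w hw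
    · intro a b ha hb
      rw [tmul_add, map_add, ha, hb, add_zero]
    · intro y v hv
      rw [← ee_t, epsV_ee]

/-- the universal property of exactness: it holds as soon as `g` embeds in `U(g)` -/
theorem exact_VV [CharZero k] (hinj : Function.Injective (iu k (g := g))) (n : ℕ) (v : KV k g)
    (hv : v ∈ VV k n) (hdv : dd k v = 0) (hεv : epsV k v = 0) :
    ∃ y ∈ VV k (n + 1), dd k y = v := by
  obtain ⟨r, hr⟩ := (iu k (g := g)).exists_leftInverse_of_injective (LinearMap.ker_eq_bot.2 hinj)
  have hr' : ∀ x, r (iu k x) = x := fun x => LinearMap.congr_fun hr x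
  obtain ⟨p, hp⟩ := VV_exhaust k v hv
  refine exact_FV k (D := r - (eps0 k).toLinearMap.smulRight (r 1)) ?_ ?_ (epsV k) (epsV_dd k)
    (epsV_one k) p n v hp hdv hεv
  · intro x
    simp [hr', eps0_iu]
  · simp

end aug

section inj

attribute [local instance] LieRing.ofAssociativeRing

variable (k : Type*) [Field k]

/-- over a field, a linear map that kills the kernel of another one factors through it -/
theorem exists_factor {V W A : Type*} [AddCommGroup V] [Module k V] [AddCommGroup W] [Module k W]
    [AddCommGroup A] [Module k A] (f : V →ₗ[k] W) (h : V →ₗ[k] A)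
    (hk : ∀ v, f v = 0 → h v = 0) : ∃ F : W →ₗ[k] A, ∀ v, F (f v) = h v := by
  obtain ⟨σ, hσ⟩ := f.rangeRestrict.exists_rightInverse_of_surjective f.range_rangeRestrict
  obtain ⟨F, hF⟩ := LinearMap.exists_extend (h ∘ₗ σ)
  refine ⟨F, fun v => ?_⟩
  have h1 : F (f v) = h (σ (f.rangeRestrict v)) := LinearMap.congr_fun hF (f.rangeRestrict v)
  have h2 : f.rangeRestrict (σ (f.rangeRestrict v)) = f.rangeRestrict v :=
    LinearMap.congr_fun hσ (f.rangeRestrict v)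
  have h3 : f (σ (f.rangeRestrict v)) = f v := congrArg Subtype.val h2
  have h4 := hk (σ (f.rangeRestrict v) - v) (by rw [map_sub, h3, sub_self])
  rw [map_sub, sub_eq_zero] at h4
  rw [h1, h4]

variable {Q A : Type*} [LieRing Q] [LieAlgebra k Q] [AddCommGroup A] [Module k A]

/-- step function for extending a `2`-cochain to the exterior algebra -/
noncomputable def stepC (c : Q →ₗ[k] Q →ₗ[k] A) : Q →ₗ[k] (k × Q × A) →ₗ[k] (k × Q × A) :=
  LinearMap.mk₂ k (fun y p => (0, p.1 • y, c y p.2.1))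
    (fun a b p => by simp)
    (fun a b p => by simp [smul_comm p.1 a])
    (fun a p q => by simp [add_smul])
    (fun a b p => by simp [mul_smul])

/-- extension of a `2`-cochain to the exterior algebra -/
noncomputable def cL (c : Q →ₗ[k] Q →ₗ[k] A) (hc : ∀ x, c x x = 0) :
    KL k Q →ₗ[k] (k × Q × A) :=
  CliffordAlgebra.foldr 0 (stepC k c) (by
    intro m p
    simp [stepC, hc]) (1, 0, 0)

theorem cL_one (c : Q →ₗ[k] Q →ₗ[k] A) (hc : ∀ x, c x x = 0) : cL k c hc 1 = (1, 0, 0) :=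
  CliffordAlgebra.foldr_one _ _ _ _

theorem cL_mul (c : Q →ₗ[k] Q →ₗ[k] A) (hc : ∀ x, c x x = 0) (y : Q) (w : KL k Q) :
    cL k c hc (il k y * w) = (0, (cL k c hc w).1 • y, c y (cL k c hc w).2.1) := by
  unfold cL
  rw [CliffordAlgebra.foldr_mul]
  erw [CliffordAlgebra.foldr_ι]
  rfl

/-- the cochain with values in `A` on the Koszul complex -/
noncomputable def cV (c : Q →ₗ[k] Q →ₗ[k] A) (hc : ∀ x, c x x = 0) : KV k Q →ₗ[k] A :=
  TensorProduct.lift (LinearMap.mk₂ k (fun u w => eps0 k u • (cL k c hc w).2.2)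
    (fun a b w => by simp [add_smul])
    (fun a b w => by simp [mul_smul])
    (fun a v w => by simp)
    (fun a u w => by simp [smul_comm _ a]))

theorem cV_t (c : Q →ₗ[k] Q →ₗ[k] A) (hc : ∀ x, c x x = 0) (u : KU k Q) (w : KL k Q) :
    cV k c hc (u ⊗ₜ w) = eps0 k u • (cL k c hc w).2.2 := rfl

theorem cV_dd (c : Q →ₗ[k] Q →ₗ[k] A) (hc : ∀ x, c x x = 0)
    (hJ : ∀ x y z, c x ⁅y, z⁆ = c ⁅x, y⁆ z + c y ⁅x, z⁆) (v : KV k Q) (hv : v ∈ VV k 3) :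
    cV k c hc (dd k v) = 0 := by
  refine map2_ind k _ (P := fun v => cV k c hc (dd k v) = 0) ?_ (by simp) ?_ v hv
  · intro a b ha hb
    rw [map_add, map_add, ha, hb, add_zero]
  intro u _ w hw
  refine Ep_succ_ind k (P := fun w => cV k c hc (dd k (u ⊗ₜ w)) = 0) ?_ ?_ w hw
  · intro a b ha hb
    rw [tmul_add, map_add, map_add, ha, hb, add_zero]
  intro x w hw
  refine Ep_succ_ind k (P := fun w => cV k c hc (dd k (u ⊗ₜ (il k x * w))) = 0) ?_ ?_ w hw
  · intro a b ha hb
    rw [mul_add, tmul_add, map_add, map_add, ha, hb, add_zero]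
  intro y w hw
  refine Ep_succ_ind k
    (P := fun w => cV k c hc (dd k (u ⊗ₜ (il k x * (il k y * w)))) = 0) ?_ ?_ w hw
  · intro a b ha hb
    rw [mul_add, mul_add, tmul_add, map_add, map_add, ha, hb, add_zero]
  intro z w hw
  obtain ⟨a, rfl⟩ := Ep_zero k w hw
  simp only [mul_smul_comm, tmul_smul, map_smul]
  simp only [dd_mul, LL_mul, LL_one, dd_one, map_sub, map_add, map_zero, ee_t, cV_t, cL_mul, cL_one,
    tmul_add, map_mul, eps0_iu, mul_zero, zero_smul, smul_zero, one_smul, add_zero, zero_add,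
    sub_zero, zero_sub, hJ x y z, smul_add, tmul_zero]
  convert smul_zero a using 2
  abel

theorem exists_F [CharZero k] (hinj : Function.Injective (iu k (g := Q)))
    (c : Q →ₗ[k] Q →ₗ[k] A) (hc : ∀ x, c x x = 0)
    (hJ : ∀ x y z, c x ⁅y, z⁆ = c ⁅x, y⁆ z + c y ⁅x, z⁆) :
    ∃ F : KU k Q →ₗ[k] Q →ₗ[k] A, ∀ u x y,
      F (u * iu k x) y - F (u * iu k y) x - F u ⁅x, y⁆ = eps0 k u • c x y := by
  obtain ⟨F, hF⟩ := exists_factor k (dd k ∘ₗ (VV k (g := Q) 2).subtype)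
    (cV k c hc ∘ₗ (VV k (g := Q) 2).subtype) (by
      rintro ⟨v, hv⟩ h
      obtain ⟨y, hy, rfl⟩ := exact_VV k hinj 2 v hv h (epsV_VV k 1 v hv)
      exact cV_dd k c hc hJ y hy)
  refine ⟨LinearMap.mk₂ k (fun u y => F (u ⊗ₜ il k y)) ?_ ?_ ?_ ?_, ?_⟩
  · intro a b y; rw [add_tmul, map_add]
  · intro a b y; rw [← smul_tmul', map_smul]
  · intro a b y; rw [map_add, tmul_add, map_add]
  · intro a b y; rw [map_smul, tmul_smul, map_smul]
  · intro u x y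
    have h1 : u ⊗ₜ (il k x * (il k y * 1)) ∈ VV k (g := Q) 2 :=
      Submodule.apply_mem_map₂ _ trivial (Ep_mul k x (Ep_mul k y (by
        change (1 : KL k Q) ∈ LinearMap.range (il k) ^ 0
        rw [pow_zero]; exact Submodule.one_le.1 le_rfl)))
    have h2 := hF ⟨_, h1⟩
    simp only [LinearMap.comp_apply, Submodule.subtype_apply] at h2
    rw [dd_mul, dd_mul, LL_mul, LL_one, dd_one, cV_t, cL_mul, cL_mul, cL_one] at h2
    simp only [mul_one, mul_zero, zero_add, map_zero, sub_zero, map_sub, ee_t, LL_one, tmul_zero,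
      one_smul] at h2
    simp only [LinearMap.mk₂_apply]
    rw [← h2]
    abel

theorem iu_eq_zero {g B : Type*} [LieRing g] [LieAlgebra k g] [Ring B] [Algebra k B]
    (f : g →ₗ⁅k⁆ B) {x : g} (hx : iu k x = 0) : f x = 0 := by
  rw [← UniversalEnvelopingAlgebra.lift_ι_apply k f x, ← iu_apply, hx, map_zero]

theorem iu_inj_of {g : Type*} [LieRing g] [LieAlgebra k g] [CharZero k]
    (hinj : Function.Injective (iu k (g := Q))) (π : g →ₗ⁅k⁆ Q) (hπ : Function.Surjective π)
    (hker : ∀ z, π z = 0 → ∀ a : g, ⁅z, a⁆ = 0) (hπ0 : ∀ x, iu k x = 0 → π x = 0) :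
    Function.Injective (iu k (g := g)) := by
  obtain ⟨s, hs⟩ := (π : g →ₗ[k] Q).exists_rightInverse_of_surjective (LinearMap.range_eq_top.2 hπ)
  replace hs : ∀ x, π (s x) = x := fun x => LinearMap.congr_fun hs x
  have hl : ∀ a a' b : g, π a = π a' → ⁅a, b⁆ = ⁅a', b⁆ := by
    intro a a' b h
    have := hker (a - a') (by rw [map_sub, h, sub_self]) b
    rwa [sub_lie, sub_eq_zero] at this
  have hl2 : ∀ a a' b b' : g, π a = π a' → π b = π b' → ⁅a, b⁆ = ⁅a', b'⁆ := by
    intro a a' b b' h h'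
    rw [hl a a' b h, ← lie_skew, hl b b' a' h', lie_skew]
  let c : Q →ₗ[k] Q →ₗ[k] g := LinearMap.mk₂ k (fun x y => ⁅s x, s y⁆ - s ⁅x, y⁆)
    (fun a b w => by simp only [map_add, add_lie]; abel)
    (fun a b w => by simp [smul_sub])
    (fun a v w => by simp only [map_add, lie_add]; abel)
    (fun a u w => by simp [smul_sub])
  have hcd : ∀ x y, c x y = ⁅s x, s y⁆ - s ⁅x, y⁆ := fun x y => rfl
  obtain ⟨F, hF⟩ := exists_F k hinj c (fun x => by simp [hcd]) (fun x y z => by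
    simp only [hcd]
    rw [hl2 (s x) (s x) (s ⁅y, z⁆) ⁅s y, s z⁆ rfl (by simp [hs]),
      hl2 (s y) (s y) (s ⁅x, z⁆) ⁅s x, s z⁆ rfl (by simp [hs]),
      hl2 (s ⁅x, y⁆) ⁅s x, s y⁆ (s z) (s z) (by simp [hs]) rfl, leibniz_lie x y z,
      leibniz_lie (s x) (s y) (s z), map_add]
    abel)
  let θ : g →ₗ[k] KU k Q →ₗ[k] g :=
    LinearMap.mk₂ k (fun a u => F u (π a) + eps0 k u • (a - s (π a)))
    (fun a b w => by simp only [map_add, smul_sub, smul_add]; abel)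
    (fun a b w => by simp [smul_sub, smul_comm (eps0 k w)])
    (fun a v w => by simp only [map_add, LinearMap.add_apply, add_smul]; abel)
    (fun a u w => by simp [mul_smul])
  have hθ : ∀ a u, θ a u = F u (π a) + eps0 k u • (a - s (π a)) := fun _ _ => rfl
  have hθl : ∀ a b u, θ ⁅a, b⁆ u = θ b (u * iu k (π a)) - θ a (u * iu k (π b)) := by
    intro a b u
    have h1 := hF u (π a) (π b)
    simp only [hθ, map_mul, eps0_iu, mul_zero, zero_smul, add_zero, LieHom.map_lie]
    rw [hcd, hl2 (s (π a)) a (s (π b)) b (by simp [hs]) (by simp [hs])] at h1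
    rw [← h1]
    abel
  let ρ₀ : g →ₗ[k] Module.End k ((KU k Q →ₗ[k] g) × k) :=
    LinearMap.mk₂ k (fun a p => (p.1 ∘ₗ LinearMap.mulRight k (iu k (π a)) + p.2 • θ a, 0))
    (fun a b p => by
      ext u <;> simp [mul_add]
      abel)
    (fun t a p => by
      ext u <;> simp [smul_comm t])
    (fun a p q => by
      ext u <;> simp [add_smul]
      abel)
    (fun t a p => by
      ext u <;> simp [mul_smul])
  have hρ₀ : ∀ a p, ρ₀ a p = (p.1 ∘ₗ LinearMap.mulRight k (iu k (π a)) + p.2 • θ a, 0) :=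
    fun _ _ => rfl
  let ρ : g →ₗ⁅k⁆ Module.End k ((KU k Q →ₗ[k] g) × k) :=
    { ρ₀ with
      map_lie' := by
        intro a b
        change ρ₀ ⁅a, b⁆ = ⁅ρ₀ a, ρ₀ b⁆
        refine LinearMap.ext fun p => ?_
        rw [LieRing.of_associative_ring_bracket, LinearMap.sub_apply, Module.End.mul_apply,
          Module.End.mul_apply]
        simp only [hρ₀]
        refine Prod.ext (LinearMap.ext fun u => ?_) (by simp)
        simp [hθl, iu_lie, mul_sub, mul_assoc, smul_sub]
        abel }
  rw [injective_iff_map_eq_zero]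
  intro x hx
  have h1 := hπ0 x hx
  have h2 : ρ₀ x = 0 := iu_eq_zero k ρ hx
  have h3 : (ρ₀ x (0, 1)).1 1 = 0 := by rw [h2]; rfl
  rw [hρ₀] at h3
  simpa [hθ, h1] using h3

theorem iu_injective (g : Type*) [LieRing g] [LieAlgebra k g] [CharZero k] :
    Function.Injective (iu k (g := g)) := by
  have had : ∀ x : g, (LieAlgebra.ad k g).rangeRestrict x = 0 ↔ LieAlgebra.ad k g x = 0 :=
    fun x => Subtype.ext_iff
  refine iu_inj_of (Q := (LieAlgebra.ad k g).range) k ?_ (LieAlgebra.ad k g).rangeRestrict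
    (LieHom.surjective_rangeRestrict _) ?_ ?_
  · rw [injective_iff_map_eq_zero]
    intro q hq
    exact Subtype.ext (iu_eq_zero k (LieAlgebra.ad k g).range.incl hq)
  · intro z hz a
    rw [had] at hz
    rw [← LieAlgebra.ad_apply k, hz]; rfl
  · intro x hx
    rw [had]
    exact iu_eq_zero k (LieAlgebra.ad k g) hx

end inj

section formula

variable (k : Type*) {g : Type*} [Field k] [LieRing g] [LieAlgebra k g]

/-- the wedge in the exterior algebra -/
noncomputable abbrev W (n : ℕ) (v : Fin n → g) : KL k g := ExteriorAlgebra.ιMulti k n v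

theorem W_zero (v : Fin 0 → g) : W k 0 v = 1 := ExteriorAlgebra.ιMulti_zero_apply v

theorem W_succ (n : ℕ) (v : Fin (n + 1) → g) :
    W k (n + 1) v = il k (v 0) * W k n (fun i => v i.succ) :=
  ExteriorAlgebra.ιMulti_succ_apply v

theorem LL_W (x : g) (n : ℕ) (v : Fin (n + 1) → g) :
    LL k x (W k (n + 1) v) =
      ∑ j : Fin (n + 1), (-1 : k) ^ (j : ℕ) • (il k ⁅x, v j⁆ * W k n (v ∘ j.succAbove)) := by
  induction n with
  | zero =>
    rw [W_succ, W_zero, LL_mul, LL_one]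
    simp
  | succ n ih =>
    rw [W_succ, LL_mul, ih, Finset.mul_sum, Fin.sum_univ_succ (n := n + 1), add_comm]
    congr 1
    · simp [Function.comp_def]
    · refine Finset.sum_congr rfl fun j _ => ?_
      rw [W_succ k n, mul_smul_comm, il_swap', Fin.val_succ, pow_succ]
      simp [Function.comp_def]

theorem W_consRemove2_zero (n : ℕ) (a : g) (v : Fin (n + 2) → g) (j : Fin (n + 1)) :
    W k (n + 1) (consRemove2 a v 0 j.succ) =
      il k a * W k n ((fun i => v i.succ) ∘ j.succAbove) := by
  rw [W_succ]
  congr 2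
  funext l
  simp only [consRemove2, Fin.val_succ, Nat.succ_ne_zero, dite_false, Function.comp]
  congr 1
  ext
  simp only [remove2Idx, Fin.succAbove, Fin.lt_def, Fin.val_castSucc, Fin.val_succ, Fin.val_zero]
  by_cases hlj : (l : ℕ) < j
  · simp [hlj]
  · simp [hlj]

theorem W_consRemove2_succ (n : ℕ) (a : g) (v : Fin (n + 2) → g) (i j : Fin (n + 1)) (h : i < j) :
    W k (n + 1) (consRemove2 a v i.succ j.succ) =
      -(il k (v 0) * W k n (consRemove2 a (fun i => v i.succ) i j)) := by
  cases n with
  | zero => omega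
  | succ m =>
    rw [W_succ, W_succ, W_succ, il_swap']
    congr 3
    · congr 2
      funext l
      simp only [consRemove2, Fin.val_succ, Nat.succ_ne_zero, dite_false]
      congr 1
      ext
      simp only [remove2Idx, Fin.val_succ]
      split_ifs <;> omega

theorem dd_W (n : ℕ) (u : KU k g) (v : Fin (n + 1) → g) :
    dd k (u ⊗ₜ W k (n + 1) v) =
      (∑ i : Fin (n + 1), ((-1 : k) ^ (i : ℕ)) •
        ((u * iu k (v i)) ⊗ₜ[k] W k n (v ∘ i.succAbove))) +
      ∑ p : Fin (n + 1) × Fin (n + 1),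
        if p.1 < p.2 then
          ((-1 : k) ^ ((p.1 : ℕ) + (p.2 : ℕ))) •
            (u ⊗ₜ[k] W k n (consRemove2 ⁅v p.1, v p.2⁆ v p.1 p.2))
        else 0 := by
  induction n with
  | zero =>
    rw [W_succ, W_zero, dd_mul, LL_one, dd_one]
    simp [Fintype.sum_prod_type]
  | succ n ih =>
    rw [W_succ, dd_mul, ih, LL_W]
    have e1 : ee k (v 0) (∑ i : Fin (n + 1), ((-1 : k) ^ (i : ℕ)) •
        ((u * iu k (v i.succ)) ⊗ₜ[k] W k n ((fun i => v i.succ) ∘ i.succAbove))) =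
        - ∑ i : Fin (n + 1), ((-1 : k) ^ (i.succ : ℕ)) •
        ((u * iu k (v i.succ)) ⊗ₜ[k] W k (n + 1) (v ∘ i.succ.succAbove)) := by
      rw [map_sum, ← Finset.sum_neg_distrib]
      refine Finset.sum_congr rfl fun i _ => ?_
      rw [map_smul, ee_t, W_succ k n, Fin.val_succ, pow_succ]
      simp [Function.comp_def]
    have e2 : u ⊗ₜ[k] (∑ j : Fin (n + 1), (-1 : k) ^ (j : ℕ) • (il k ⁅v 0, v j.succ⁆ *
        W k n ((fun i => v i.succ) ∘ j.succAbove))) =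
        - ∑ j : Fin (n + 1), (if (0 : Fin (n + 2)) < j.succ then
          ((-1 : k) ^ (((0 : Fin (n + 2)) : ℕ) + (j.succ : ℕ))) •
            (u ⊗ₜ[k] W k (n + 1) (consRemove2 ⁅v 0, v j.succ⁆ v 0 j.succ))
        else 0) := by
      rw [tmul_sum, ← Finset.sum_neg_distrib]
      refine Finset.sum_congr rfl fun j _ => ?_
      rw [if_pos (Fin.succ_pos j), W_consRemove2_zero, tmul_smul, Fin.val_zero, zero_add,
        Fin.val_succ, pow_succ, mul_neg_one, neg_smul, neg_neg]
    have e3 : ee k (v 0) (∑ p : Fin (n + 1) × Fin (n + 1),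
        if p.1 < p.2 then
          ((-1 : k) ^ ((p.1 : ℕ) + (p.2 : ℕ))) •
            (u ⊗ₜ[k] W k n (consRemove2 ⁅v p.1.succ, v p.2.succ⁆ (fun i => v i.succ) p.1 p.2))
        else 0) = - ∑ i : Fin (n + 1), ∑ j : Fin (n + 2),
        (if i.succ < j then
          ((-1 : k) ^ ((i.succ : ℕ) + (j : ℕ))) •
            (u ⊗ₜ[k] W k (n + 1) (consRemove2 ⁅v i.succ, v j⁆ v i.succ j))
        else 0) := by
      rw [map_sum, Fintype.sum_prod_type, ← Finset.sum_neg_distrib]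
      refine Finset.sum_congr rfl fun i _ => ?_
      rw [Fin.sum_univ_succ (n := n + 1), if_neg (by simp), zero_add, ← Finset.sum_neg_distrib]
      refine Finset.sum_congr rfl fun j _ => ?_
      by_cases h : i < j
      · rw [if_pos h, if_pos (Fin.succ_lt_succ_iff.2 h), W_consRemove2_succ k n _ v i j h,
          map_smul, ee_t, Fin.val_succ, Fin.val_succ, tmul_neg, smul_neg, neg_neg]
        congr 1
        ring
      · rw [if_neg h, if_neg (fun h' => h (Fin.succ_lt_succ_iff.1 h')), map_zero, neg_zero]
    rw [map_add, e1, e2, e3, Fintype.sum_prod_type, Fin.sum_univ_succ (n := n + 1),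
      Fin.sum_univ_succ (n := n + 1), Fin.sum_univ_succ (n := n + 1), if_neg (lt_irrefl _)]
    simp only [Fin.val_zero, pow_zero, one_smul, zero_add, Fin.succAbove_zero, Function.comp_def]
    abel

end formula

section glue

variable (k : Type*) {g : Type*} [Field k] [LieRing g] [LieAlgebra k g]

/-- the inclusion of `V_n` in the total space -/
noncomputable def JJ (n : ℕ) : KU k g ⊗[k] (⋀[k]^n g) →ₗ[k] KV k g :=
  LinearMap.lTensor _ (Submodule.subtype (⋀[k]^n g))

theorem JJ_t (n : ℕ) (u : KU k g) (w : ⋀[k]^n g) : JJ k n (u ⊗ₜ w) = u ⊗ₜ (w : KL k g) := rfl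

theorem JJ_inj (n : ℕ) : Function.Injective (JJ k (g := g) n) :=
  Module.Flat.lTensor_preserves_injective_linearMap _ (Submodule.subtype_injective _)

theorem JJ_mem (n : ℕ) (t : KU k g ⊗[k] (⋀[k]^n g)) : JJ k n t ∈ VV k n := by
  induction t using TensorProduct.induction_on with
  | zero => rw [map_zero]; exact zero_mem _
  | tmul u w => exact Submodule.apply_mem_map₂ _ trivial w.2
  | add a b ha hb => rw [map_add]; exact add_mem ha hb

theorem JJ_surj (n : ℕ) (v : KV k g) (hv : v ∈ VV k n) : ∃ t, JJ k n t = v := by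
  refine map2_ind k _ (P := fun v => ∃ t, JJ k n t = v) ?_ ⟨0, map_zero _⟩ ?_ v hv
  · rintro _ _ ⟨a, rfl⟩ ⟨b, rfl⟩
    exact ⟨a + b, map_add _ _ _⟩
  · intro u _ w hw
    exact ⟨u ⊗ₜ ⟨w, hw⟩, rfl⟩

/-- induction on `V_n` -/
theorem V_ind {n : ℕ} {P : KU k g ⊗[k] (⋀[k]^n g) → Prop} (h0 : P 0)
    (ha : ∀ a b, P a → P b → P (a + b)) (hw : ∀ u v, P (u ⊗ₜ wedge k n v)) (t) : P t := by
  induction t using TensorProduct.induction_on with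
  | zero => exact h0
  | add a b h h' => exact ha a b h h'
  | tmul u w =>
    have hw' : w ∈ Submodule.span k (Set.range (exteriorPower.ιMulti k n (M := g))) := by
      rw [exteriorPower.ιMulti_span]; trivial
    induction hw' using Submodule.span_induction generalizing u with
    | mem x hx => obtain ⟨v, rfl⟩ := hx; exact hw u v
    | zero => rw [tmul_zero]; exact h0
    | add x y _ _ hx hy => rw [tmul_add]; exact ha _ _ (hx u) (hy u)
    | smul c x _ hx => rw [tmul_smul, smul_tmul']; exact hx _

theorem JJ_d (n : ℕ) (d : (KU k g ⊗[k] ⋀[k]^(n + 1) g) →ₗ[k] (KU k g ⊗[k] ⋀[k]^n g))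
    (hd : ∀ (u : UniversalEnvelopingAlgebra k g) (v : Fin (n + 1) → g),
      d (u ⊗ₜ[k] wedge k (n + 1) v) =
        (∑ i : Fin (n + 1),
            ((-1 : k) ^ (i : ℕ)) •
              ((u * UniversalEnvelopingAlgebra.ι k (v i)) ⊗ₜ[k] wedge k n (v ∘ i.succAbove))) +
          ∑ p : Fin (n + 1) × Fin (n + 1),
            if p.1 < p.2 then
              ((-1 : k) ^ ((p.1 : ℕ) + (p.2 : ℕ))) •
                (u ⊗ₜ[k] wedge k n (consRemove2 ⁅v p.1, v p.2⁆ v p.1 p.2))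
            else 0) (t) : JJ k n (d t) = dd k (JJ k (n + 1) t) := by
  refine V_ind k (P := fun t => JJ k n (d t) = dd k (JJ k (n + 1) t)) ?_ ?_ ?_ t
  · simp only [map_zero]
  · intro a b ha hb
    simp only [map_add, ha, hb]
  · intro u v
    have h := dd_W k n u v
    rw [hd, map_add, map_sum, map_sum]
    refine Eq.trans ?_ h.symm
    congr 1
    · refine Finset.sum_congr rfl fun p _ => ?_
      split_ifs
      · rw [map_smul]
        rfl
      · rw [map_zero]

theorem JJ_e (ε : KU k g →ₐ[k] k)
    (hε : ∀ x : g, ε (UniversalEnvelopingAlgebra.ι k x) = 0)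
    (e : (KU k g ⊗[k] ⋀[k]^0 g) →ₗ[k] k)
    (he : ∀ u : UniversalEnvelopingAlgebra k g, e (u ⊗ₜ[k] wedge k 0 ![]) = ε u) (t) :
    epsV k (JJ k 0 t) = e t := by
  have hεε : ∀ u, ε u = eps0 k u := by
    intro u
    induction u using KU_ind with
    | h1 c => simp
    | ha a b ha hb => rw [map_add, map_add, ha, hb]
    | hi x => rw [eps0_iu, iu_apply, hε]
    | hm a b ha hb => rw [map_mul, map_mul, ha, hb]
  refine V_ind k (P := fun t => epsV k (JJ k 0 t) = e t) ?_ ?_ ?_ t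
  · simp only [map_zero]
  · intro a b ha hb
    simp only [map_add, ha, hb]
  · intro u v
    have hv : v = ![] := Subsingleton.elim _ _
    have h1 : ((wedge k 0 (![] : Fin 0 → g) : ⋀[k]^0 g) : KL k g) = 1 := W_zero k _
    rw [hv, he, hεε, JJ_t, h1, epsV_t, map_one, mul_one]

end glue

end Koszul

theorem koszul_complex_is_projective_resolution_of_trivial_module
    (k g : Type*) [Field k] [CharZero k] [LieRing g] [LieAlgebra k g]
    (d : ∀ n : ℕ,
      (UniversalEnvelopingAlgebra k g ⊗[k] ⋀[k]^(n + 1) g) →ₗ[k]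
        (UniversalEnvelopingAlgebra k g ⊗[k] ⋀[k]^n g))
    (hd : ∀ (n : ℕ) (u : UniversalEnvelopingAlgebra k g) (v : Fin (n + 1) → g),
      d n (u ⊗ₜ[k] wedge k (n + 1) v) =
        (∑ i : Fin (n + 1),
            ((-1 : k) ^ (i : ℕ)) •
              ((u * UniversalEnvelopingAlgebra.ι k (v i)) ⊗ₜ[k] wedge k n (v ∘ i.succAbove))) +
          ∑ p : Fin (n + 1) × Fin (n + 1),
            if p.1 < p.2 then
              ((-1 : k) ^ ((p.1 : ℕ) + (p.2 : ℕ))) •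
                (u ⊗ₜ[k] wedge k n (consRemove2 ⁅v p.1, v p.2⁆ v p.1 p.2))
            else 0)
    (ε : UniversalEnvelopingAlgebra k g →ₐ[k] k)
    (hε : ∀ x : g, ε (UniversalEnvelopingAlgebra.ι k x) = 0)
    (e : (UniversalEnvelopingAlgebra k g ⊗[k] ⋀[k]^0 g) →ₗ[k] k)
    (he : ∀ u : UniversalEnvelopingAlgebra k g, e (u ⊗ₜ[k] wedge k 0 ![]) = ε u) :
    Function.Surjective e ∧
      LinearMap.range (d 0) = LinearMap.ker e ∧
      (∀ n : ℕ, LinearMap.range (d (n + 1)) = LinearMap.ker (d n)) ∧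
      (∀ n : ℕ,
        Module.Free (UniversalEnvelopingAlgebra k g)
          (UniversalEnvelopingAlgebra k g ⊗[k] ⋀[k]^n g)) ∧
      (∀ n : ℕ,
        Module.Projective (UniversalEnvelopingAlgebra k g)
          (UniversalEnvelopingAlgebra k g ⊗[k] ⋀[k]^n g)) := by
  have hJd := fun n t => Koszul.JJ_d k n (d n) (hd n) t
  have hJe := Koszul.JJ_e k ε hε e he
  have hinj := Koszul.iu_injective k g
  have hfree : ∀ n : ℕ, Module.Free (UniversalEnvelopingAlgebra k g)
      (UniversalEnvelopingAlgebra k g ⊗[k] ⋀[k]^n g) := fun n =>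
    Module.Free.of_basis (Algebra.TensorProduct.basis _ (Module.Free.chooseBasis k (⋀[k]^n g)))
  refine ⟨?_, ?_, ?_, hfree, fun n => ?_⟩
  · intro c
    refine ⟨c • (1 ⊗ₜ[k] wedge k 0 ![]), ?_⟩
    rw [map_smul, he, map_one, smul_eq_mul, mul_one]
  · refine le_antisymm ?_ ?_
    · rintro _ ⟨t, rfl⟩
      rw [LinearMap.mem_ker, ← hJe, hJd, Koszul.epsV_dd]
    · intro t ht
      rw [LinearMap.mem_ker] at ht
      have h0 : Koszul.dd k (Koszul.JJ k 0 t) = 0 := by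
        refine Koszul.V_ind k (P := fun t => Koszul.dd k (Koszul.JJ k 0 t) = 0) ?_ ?_ ?_ t
        · simp only [map_zero]
        · intro a b ha hb
          simp only [map_add, ha, hb, add_zero]
        · intro u v
          have h1 : ((wedge k 0 v : ⋀[k]^0 g) : Koszul.KL k g) = 1 := Koszul.W_zero k _
          rw [Koszul.JJ_t, h1, Koszul.dd_one]
      obtain ⟨y, hy, hyt⟩ := Koszul.exact_VV k hinj 0 _ (Koszul.JJ_mem k 0 t) h0
        (by rw [hJe, ht])
      obtain ⟨y, rfl⟩ := Koszul.JJ_surj k 1 y hy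
      exact ⟨y, Koszul.JJ_inj k 0 ((hJd 0 y).trans hyt)⟩
  · intro n
    refine le_antisymm ?_ ?_
    · rintro _ ⟨t, rfl⟩
      rw [LinearMap.mem_ker]
      apply Koszul.JJ_inj k n
      rw [hJd, hJd, Koszul.dd_dd, map_zero]
    · intro t ht
      rw [LinearMap.mem_ker] at ht
      obtain ⟨y, hy, hyt⟩ := Koszul.exact_VV k hinj (n + 1) _ (Koszul.JJ_mem k (n + 1) t)
        (by rw [← hJd, ht, map_zero]) (Koszul.epsV_VV k n _ (Koszul.JJ_mem k (n + 1) t))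
      obtain ⟨y, rfl⟩ := Koszul.JJ_surj k (n + 2) y hy
      exact ⟨y, Koszul.JJ_inj k (n + 1) ((hJd (n + 1) y).trans hyt)⟩
  · have := hfree n
    exact Module.Projective.of_free
end
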